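/- arXiv:2106.12611 — 2 statements merged into one kernel-verified Lean document; each statement's English description precedes it below -/
import Mathlib

section
/- Fix a sufficiently large d ∈ ℕ, an ℓ ≥ d³, and (ℓd)^{20} ≤ k ≤ exp(√ℓ). Consider the (ℓ+1)-layer random ReLU network with input dimension d and all hidden widths d₁ = ⋯ = d_ℓ = k. There is a universal constant C such that with probability at least 0.9 over the weights, for all x, y on the unit sphere S^{d−1}: |f(x) − f(y)| / |f(x)| ≤ C √(log d / d). -/
open MeasureTheory ProbabilityTheory

noncomputable section

/-- Euclidean norm of a finite real vector. -/
def evNorm {n : ℕ} (v : Fin n → ℝ) : ℝ := Real.sqrt (∑ i, v i ^ 2)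

/-- Matrix-vector product. -/
def mulVecFn {a b : ℕ} (M : Fin a → Fin b → ℝ) (v : Fin b → ℝ) : Fin a → ℝ :=
  fun j => ∑ k, M j k * v k

/-- Spectral (ℓ²-operator) norm of a matrix. -/
def specNorm {a b : ℕ} (M : Fin a → Fin b → ℝ) : ℝ :=
  sSup {t | ∃ v : Fin b → ℝ, evNorm v ≤ 1 ∧ t = evNorm (mulVecFn M v)}

/-- The law of an `a × b` random matrix with i.i.d. centered Gaussian entries of variance `v`. -/
def gaussMat (a b : ℕ) (v : NNReal) : Measure (Fin a → Fin b → ℝ) :=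
  Measure.pi fun _ => Measure.pi fun _ => gaussianReal 0 v

instance (a b : ℕ) (v : NNReal) : IsProbabilityMeasure (gaussMat a b v) := by
  unfold gaussMat; infer_instance

/-- Post-activation output of layer `i` of a fully connected ReLU network. -/
def forward (D : ℕ → ℕ) (w : ∀ i : ℕ, Fin (D (i+1)) → Fin (D i) → ℝ) :
    (i : ℕ) → (Fin (D 0) → ℝ) → Fin (D i) → ℝ
  | 0, x => x
  | (i+1), x => fun j => max (∑ k, w i j k * forward D w i x k) 0

/-- Pre-activation input to layer `i+1` (the quantity `f̃_{i+1}`). -/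
def preact (D : ℕ → ℕ) (w : ∀ i : ℕ, Fin (D (i+1)) → Fin (D i) → ℝ)
    (i : ℕ) (x : Fin (D 0) → ℝ) : Fin (D (i+1)) → ℝ :=
  fun j => ∑ k, w i j k * forward D w i x k

/-- Extend a finitely-indexed family of weight matrices to all of `ℕ` (zero beyond `ℓ`). -/
def extendW (ℓ : ℕ) (D : ℕ → ℕ)
    (w : ∀ i : Fin ℓ, Fin (D (i.1+1)) → Fin (D i.1) → ℝ) :
    ∀ i : ℕ, Fin (D (i+1)) → Fin (D i) → ℝ :=
  fun i => if h : i < ℓ then w ⟨i, h⟩ else fun _ _ => 0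

/-- Law of the hidden-layer weight matrices `W_1, …, W_ℓ`. -/
def hiddenMeasure (ℓ : ℕ) (D : ℕ → ℕ) :
    Measure (∀ i : Fin ℓ, Fin (D (i.1+1)) → Fin (D i.1) → ℝ) :=
  Measure.pi fun i => gaussMat (D (i.1+1)) (D i.1) (1 / (D i.1 : NNReal))

/-- Law of all the weights of the network, including the output layer `W_{ℓ+1}`. -/
def weightMeasure (ℓ : ℕ) (D : ℕ → ℕ) :
    Measure ((∀ i : Fin ℓ, Fin (D (i.1+1)) → Fin (D i.1) → ℝ) × (Fin (D ℓ) → ℝ)) :=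
  (hiddenMeasure ℓ D).prod (Measure.pi fun _ : Fin (D ℓ) => gaussianReal 0 (1 / (D ℓ : NNReal)))

/-- The scalar output of the ReLU network. -/
def netOutput (ℓ : ℕ) (D : ℕ → ℕ)
    (w : ∀ i : Fin ℓ, Fin (D (i.1+1)) → Fin (D i.1) → ℝ) (v : Fin (D ℓ) → ℝ)
    (x : Fin (D 0) → ℝ) : ℝ :=
  ∑ k, v k * forward D (extendW ℓ D w) ℓ x k

/-- second moment constant -/
def Kc : ℝ := 128 * Real.exp (1/4) * ∫ x, Real.exp (x^2/4) ∂(gaussianReal 0 1)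

lemma integrable_exp_sq : Integrable (fun x : ℝ => Real.exp (x^2/4)) (gaussianReal 0 1) := by
  rw [gaussianReal_of_var_ne_zero 0 one_ne_zero,
    integrable_withDensity_iff_integrable_smul' (measurable_gaussianPDF 0 1)
      (Filter.Eventually.of_forall fun x => gaussianPDF_lt_top)]
  have h := (integrable_exp_neg_mul_sq (b := 1/4) (by norm_num)).const_mul ((Real.sqrt (2 * Real.pi))⁻¹)
  refine h.congr (Filter.Eventually.of_forall fun x => ?_)
  simp only [toReal_gaussianPDF, gaussianPDFReal, smul_eq_mul]
  rw [mul_assoc, ← Real.exp_add]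
  simp
  left
  ring

lemma Kc_nonneg : 0 ≤ Kc := by
  unfold Kc
  have : 0 ≤ ∫ x, Real.exp (x^2/4) ∂(gaussianReal 0 1) := integral_nonneg fun x => (Real.exp_pos _).le
  positivity

lemma exp_le_quad (y : ℝ) : Real.exp y ≤ 1 + y + y^2 * Real.exp |y| := by
  by_cases h : |y| ≤ 1
  · have h1 := Real.abs_exp_sub_one_sub_id_le h
    have h2 := (abs_le.1 h1).2
    have h3 : 1 ≤ Real.exp |y| := Real.one_le_exp (abs_nonneg y)
    nlinarith [sq_nonneg y]
  · push Not at h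
    rcases le_or_gt 0 y with hy | hy
    · rw [abs_of_nonneg hy] at *
      nlinarith [Real.exp_pos y, mul_pos (Real.exp_pos y) (by linarith : (0:ℝ) < y)]
    · rw [abs_of_neg hy] at *
      have h1 : Real.exp y ≤ 1 := Real.exp_le_one_iff.2 hy.le
      have h3 : 1 ≤ Real.exp (-y) := Real.one_le_exp (by linarith)
      nlinarith [sq_nonneg y]

lemma exp_pointwise (t z g : ℝ) (ht : |t| ≤ 1/8) (hz : |z| ≤ g^2 + 1) :
    Real.exp (t * z) ≤ 1 + t * z + t^2 * (128 * Real.exp (1/4) * Real.exp (g^2/4)) := by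
  have h1 := exp_le_quad (t*z)
  have h2 : |t*z| ≤ |z|/8 := by
    rw [abs_mul]; nlinarith [abs_nonneg z]
  have h3 : Real.exp |t*z| ≤ Real.exp (|z|/8) := Real.exp_le_exp.2 h2
  have h4 : z^2 ≤ 128 * Real.exp (|z|/8) := by
    have := Real.quadratic_le_exp_of_nonneg (x := |z|/8) (by positivity)
    rw [← sq_abs z]
    nlinarith [abs_nonneg z]
  have h5 : Real.exp (|z|/8) * Real.exp (|z|/8) ≤ Real.exp (1/4) * Real.exp (g^2/4) := by
    rw [← Real.exp_add, ← Real.exp_add]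
    apply Real.exp_le_exp.2; linarith
  have h6 : z^2 * Real.exp |t*z| ≤ 128 * (Real.exp (1/4) * Real.exp (g^2/4)) := by
    calc z^2 * Real.exp |t*z| ≤ (128 * Real.exp (|z|/8)) * Real.exp (|z|/8) := by gcongr
      _ ≤ _ := by nlinarith
  nlinarith [mul_le_mul_of_nonneg_left h6 (sq_nonneg t)]

/-- moment facts from a dominating standard Gaussian -/
lemma gauss_int {R : Type*} [MeasurableSpace R] {ν : Measure R} [IsProbabilityMeasure ν]
    {G : R → ℝ} (hG : Measurable G) (hlaw : ν.map G = gaussianReal 0 1) :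
    Integrable (fun r => G r ^ 2) ν ∧ ∫ r, G r ^ 2 ∂ν = 1 ∧
    Integrable (fun r => Real.exp (G r ^2/4)) ν ∧
    128 * Real.exp (1/4) * ∫ r, Real.exp (G r ^2/4) ∂ν = Kc := by
  have e1 : Integrable (fun x : ℝ => x^2) (gaussianReal 0 1) := by
    have := (memLp_id_gaussianReal (μ := 0) (v := 1) 2)
    exact this.integrable_sq
  have e2 : ∫ x : ℝ, x^2 ∂(gaussianReal 0 1) = 1 := by
    have h := variance_id_gaussianReal (μ := 0) (v := 1)
    rw [variance_of_integral_eq_zero aemeasurable_id (by simp)] at h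
    simpa using h
  refine ⟨?_, ?_, ?_, ?_⟩
  · rw [← hlaw] at e1
    exact e1.comp_measurable hG
  · rw [← e2, ← hlaw, integral_map hG.aemeasurable (by fun_prop)]
  · have := integrable_exp_sq
    rw [← hlaw] at this
    exact this.comp_measurable hG
  · unfold Kc
    rw [← hlaw, integral_map hG.aemeasurable (by fun_prop)]

lemma conc_upper {R : Type*} [MeasurableSpace R] (ν : Measure R) [IsProbabilityMeasure ν]
    (Y G : R → ℝ) (hY : Measurable Y) (hG : Measurable G) (hlaw : ν.map G = gaussianReal 0 1)
    (hYG : ∀ r, |Y r| ≤ G r ^ 2) (k : ℕ) (hk : 64 ≤ k) (τ : ℝ) :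
    (Measure.pi fun _ : Fin k => ν) {W | (k:ℝ) * (∫ r, Y r ∂ν + τ) ≤ ∑ j, Y (W j)} ≤
      ENNReal.ofReal (Real.exp (Kc - Real.sqrt k * τ)) := by
  obtain ⟨i1, i2, i3, i4⟩ := gauss_int hG hlaw
  have hkr : (64:ℝ) ≤ k := by exact_mod_cast hk
  have hs8 : 8 ≤ Real.sqrt k := by
    rw [show (8:ℝ) = Real.sqrt 64 by
      rw [show (64:ℝ) = 8^2 by norm_num, Real.sqrt_sq (by norm_num)]]
    exact Real.sqrt_le_sqrt hkr
  have hss : Real.sqrt k * Real.sqrt k = k := Real.mul_self_sqrt (by linarith)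
  set t : ℝ := 1 / Real.sqrt k with ht
  have ht0 : 0 < t := by positivity
  have ht8 : |t| ≤ 1/8 := by
    rw [abs_of_pos ht0, ht]; exact one_div_le_one_div_of_le (by norm_num) hs8
  have iY : Integrable Y ν := i1.mono' hY.aestronglyMeasurable (Filter.Eventually.of_forall hYG)
  set m := ∫ r, Y r ∂ν with hm
  have hm1 : |m| ≤ 1 := by
    rw [← i2]
    exact (abs_integral_le_integral_abs).trans (integral_mono iY.abs i1 hYG)
  have hpt : ∀ r, Real.exp (t * (Y r - m)) ≤
      1 + t * (Y r - m) + t^2 * (128 * Real.exp (1/4) * Real.exp (G r ^2/4)) := fun r =>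
    exp_pointwise t _ _ ht8 (by
      calc |Y r - m| ≤ |Y r| + |m| := abs_sub _ _
        _ ≤ _ := add_le_add (hYG r) hm1)
  have iR : Integrable (fun r => 1 + t * (Y r - m) + t^2 * (128 * Real.exp (1/4) * Real.exp (G r ^2/4))) ν :=
    ((integrable_const 1).add ((iY.sub (integrable_const m)).const_mul t)).add
      ((i3.const_mul _).const_mul _)
  have iE : Integrable (fun r => Real.exp (t * (Y r - m))) ν := by
    refine iR.mono' (by fun_prop) (Filter.Eventually.of_forall fun r => ?_)
    rw [Real.norm_eq_abs, abs_of_pos (Real.exp_pos _)]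
    exact hpt r
  have hmgf : ∫ r, Real.exp (t * (Y r - m)) ∂ν ≤ 1 + t^2 * Kc := by
    refine (integral_mono iE iR hpt).trans (le_of_eq ?_)
    rw [integral_add, integral_add, integral_const_mul, integral_sub iY (integrable_const m),
      integral_const_mul, integral_const_mul, i4]
    · simp [← hm]
    · exact integrable_const 1
    · exact (iY.sub (integrable_const m)).const_mul t
    · exact (integrable_const 1).add ((iY.sub (integrable_const m)).const_mul t)
    · exact (i3.const_mul _).const_mul _
  have hprod : ∀ W : Fin k → R, Real.exp (t * ∑ j, (Y (W j) - m)) = ∏ j, Real.exp (t * (Y (W j) - m)) := by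
    intro W; rw [Finset.mul_sum, Real.exp_sum]
  have iP : Integrable (fun W : Fin k → R => Real.exp (t * ∑ j, (Y (W j) - m))) (Measure.pi fun _ : Fin k => ν) := by
    simp_rw [hprod]
    exact Integrable.fintype_prod (f := fun _ r => Real.exp (t * (Y r - m))) (fun _ => iE)
  have hM := measure_ge_le_exp_mul_mgf (μ := Measure.pi fun _ : Fin k => ν)
    (X := fun W : Fin k → R => ∑ j, (Y (W j) - m)) (k * τ) ht0.le iP
  have hmg : mgf (fun W : Fin k → R => ∑ j, (Y (W j) - m)) (Measure.pi fun _ : Fin k => ν) t ≤ Real.exp Kc := by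
    unfold mgf
    simp_rw [hprod]
    rw [integral_fintype_prod_eq_pow (fun r => Real.exp (t * (Y r - m)))]
    have h0 : 0 ≤ ∫ r, Real.exp (t * (Y r - m)) ∂ν := integral_nonneg fun r => (Real.exp_pos _).le
    calc _ ≤ (Real.exp (t^2 * Kc)) ^ (Fintype.card (Fin k)) := by
          apply pow_le_pow_left₀ h0
          refine hmgf.trans ?_
          linarith [Real.add_one_le_exp (t^2*Kc)]
      _ = Real.exp Kc := by
          rw [← Real.exp_nat_mul, Fintype.card_fin]
          congr 1
          rw [ht, one_div, inv_pow, Real.sq_sqrt (by linarith)]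
          field_simp
  have hset : {W : Fin k → R | (k:ℝ) * (m + τ) ≤ ∑ j, Y (W j)} = {W | k * τ ≤ ∑ j, (Y (W j) - m)} := by
    ext W; simp only [Set.mem_ofPred_eq, Finset.sum_sub_distrib]; simp
    constructor <;> intro h <;> nlinarith
  rw [hset, ← ofReal_measureReal]
  apply ENNReal.ofReal_le_ofReal
  refine hM.trans ?_
  calc _ ≤ Real.exp (-t * (k*τ)) * Real.exp Kc := by gcongr
    _ = _ := by
      rw [← Real.exp_add]; congr 1
      have : t * k = Real.sqrt k := by
        rw [ht, one_div, inv_mul_eq_iff_eq_mul₀ (by positivity), hss]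
      linear_combination (-τ) * this

/-- Law of a row. -/
abbrev rowM (b : ℕ) (s : NNReal) : Measure (Fin b → ℝ) := Measure.pi fun _ => gaussianReal 0 s

lemma row_gauss {b : ℕ} (s : NNReal) (u v : Fin b → ℝ) :
    HasGaussianLaw (fun r : Fin b → ℝ => (∑ j, r j * u j, ∑ j, r j * v j)) (rowM b s) := by
  have h1 : iIndepFun (fun i (r : Fin b → ℝ) => r i) (rowM b s) :=
    iIndepFun_pi (X := fun _ x => x) (fun i => aemeasurable_id)
  have h2 : ∀ i : Fin b, HasGaussianLaw (fun r : Fin b → ℝ => r i) (rowM b s) := by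
    intro i
    have : (rowM b s).map (fun r => r i) = gaussianReal 0 s := (measurePreserving_eval _ i).map_eq
    exact ⟨by rw [this]; infer_instance⟩
  have h3 := iIndepFun.hasGaussianLaw h2 h1
  let Lu : (Fin b → ℝ) →L[ℝ] ℝ := ∑ j, (u j) • ContinuousLinearMap.proj (R := ℝ) (φ := fun _ : Fin b => ℝ) j
  let Lv : (Fin b → ℝ) →L[ℝ] ℝ := ∑ j, (v j) • ContinuousLinearMap.proj (R := ℝ) (φ := fun _ : Fin b => ℝ) j
  have h4 := h3.map_fun (Lu.prod Lv)
  refine h4.congr (Filter.Eventually.of_forall fun r => ?_)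
  simp [Lu, Lv, mul_comm]

lemma row_memLp {b : ℕ} (s : NNReal) (i : Fin b) : MemLp (fun r : Fin b → ℝ => r i) 2 (rowM b s) := by
  have := (memLp_id_gaussianReal (μ := 0) (v := s) 2)
  exact this.comp_measurePreserving (measurePreserving_eval (fun _ : Fin b => gaussianReal 0 s) i)

lemma row_cov {b : ℕ} (s : NNReal) (u v : Fin b → ℝ) :
    cov[fun r : Fin b → ℝ => ∑ j, r j * u j, fun r => ∑ j, r j * v j; rowM b s] = s * ∑ j, u j * v j := by
  rw [covariance_fun_sum_fun_sum (fun i => (row_memLp s i).mul_const _) (fun i => (row_memLp s i).mul_const _)]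
  have h1 : iIndepFun (fun i (r : Fin b → ℝ) => r i) (rowM b s) :=
    iIndepFun_pi (X := fun _ x => x) (fun i => aemeasurable_id)
  have key : ∀ i j : Fin b, cov[fun r : Fin b → ℝ => r i * u i, fun r => r j * v j; rowM b s] =
      if i = j then s * (u i * v i) else 0 := by
    intro i j
    rw [covariance_mul_const_left, covariance_mul_const_right]
    split_ifs with h
    · subst h
      rw [covariance_self (measurable_pi_apply i).aemeasurable]
      have h2 : Var[fun r : Fin b → ℝ => r i; rowM b s] = s := by
        have h3 : (rowM b s).map (fun r => r i) = gaussianReal 0 s :=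
          (measurePreserving_eval (fun _ : Fin b => gaussianReal 0 s) i).map_eq
        rw [← variance_id_gaussianReal (μ := 0) (v := s), ← h3,
          variance_map aemeasurable_id (measurable_pi_apply i).aemeasurable]
        rfl
      rw [h2]; ring
    · rw [(h1.indepFun h).covariance_eq_zero (row_memLp s i) (row_memLp s j)]; simp
  simp_rw [key]
  simp [Finset.mul_sum]

lemma row_mean {b : ℕ} (s : NNReal) (u : Fin b → ℝ) : ∫ r, ∑ j, r j * u j ∂(rowM b s) = 0 := by
  rw [integral_finsetSum _ fun i _ => ((row_memLp s i).integrable (by norm_num)).mul_const _]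
  apply Finset.sum_eq_zero
  intro i _
  rw [integral_mul_const]
  have : ∫ r, r i ∂(rowM b s) = 0 := by
    have h := (measurePreserving_eval (fun _ : Fin b => gaussianReal 0 s) i).map_eq
    have h2 := integral_id_gaussianReal (μ := 0) (v := s)
    rw [← h, integral_map (measurable_pi_apply i).aemeasurable (by fun_prop)] at h2
    exact h2
  rw [this, zero_mul]

lemma row_law {b : ℕ} (s : NNReal) (u : Fin b → ℝ) (q : NNReal) (hq : (q:ℝ) = s * ∑ j, u j ^ 2) :
    (rowM b s).map (fun r => ∑ j, r j * u j) = gaussianReal 0 q := by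
  have h := (row_gauss s u u).fst
  rw [h.map_eq_gaussianReal, row_mean]
  congr 1
  rw [← covariance_self (Measurable.aemeasurable (by fun_prop)), row_cov]
  apply NNReal.eq
  rw [Real.coe_toNNReal]
  · rw [hq]; congr 1; exact Finset.sum_congr rfl fun i _ => by ring
  · exact mul_nonneg s.2 (Finset.sum_nonneg fun i _ => mul_self_nonneg _)

lemma row_indep {b : ℕ} (s : NNReal) (u v : Fin b → ℝ) (h : ∑ j, u j * v j = 0) :
    IndepFun (fun r : Fin b → ℝ => ∑ j, r j * u j) (fun r => ∑ j, r j * v j) (rowM b s) :=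
  (row_gauss s u v).indepFun_of_covariance_eq_zero (by rw [row_cov, h, mul_zero])

lemma row_neg {b : ℕ} (s : NNReal) : MeasurePreserving (fun r : Fin b → ℝ => fun j => - r j) (rowM b s) (rowM b s) := by
  apply measurePreserving_pi
  intro i
  refine ⟨by fun_prop, ?_⟩
  have := gaussianReal_map_neg (μ := 0) (v := s)
  simpa using this

lemma conc_scaled {R : Type*} [MeasurableSpace R] (ν : Measure R) [IsProbabilityMeasure ν]
    (Y A : R → ℝ) (hY : Measurable Y) (hA : Measurable A) (q : NNReal)
    (hlaw : ν.map A = gaussianReal 0 q)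
    (hYG : ∀ r, |Y r| ≤ A r ^ 2) (h0 : q = 0 → ∀ r, Y r = 0) (k : ℕ) (hk : 64 ≤ k) (τ : ℝ) :
    (Measure.pi fun _ : Fin k => ν) {W | (k:ℝ) * (∫ r, Y r ∂ν + τ * q) < ∑ j, Y (W j)} ≤
      ENNReal.ofReal (Real.exp (Kc - Real.sqrt k * τ)) := by
  by_cases hq : q = 0
  · have : {W : Fin k → R | (k:ℝ) * (∫ r, Y r ∂ν + τ * q) < ∑ j, Y (W j)} = ∅ := by
      ext W; simp [h0 hq, hq]
    rw [this]; simp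
  have hqp : (0:ℝ) < q := by positivity
  have hsq : 0 < Real.sqrt q := Real.sqrt_pos.2 hqp
  have hss : Real.sqrt q ^ 2 = q := Real.sq_sqrt hqp.le
  have hlaw' : ν.map (fun r => A r / Real.sqrt q) = gaussianReal 0 1 := by
    have : (fun r => A r / Real.sqrt q) = (fun x => x / Real.sqrt q) ∘ A := rfl
    rw [this, ← Measure.map_map (by fun_prop) hA, hlaw, gaussianReal_map_div_const]
    congr 1
    · simp
    · apply NNReal.eq; simp [hss, hq]
  have := conc_upper ν (fun r => Y r / q) (fun r => A r / Real.sqrt q) (by fun_prop) (by fun_prop) hlaw'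
    (fun r => by
      rw [abs_div, abs_of_pos hqp, div_pow, hss]
      exact div_le_div_of_nonneg_right (hYG r) hqp.le) k hk τ
  refine le_trans (measure_mono ?_) this
  intro W hW
  simp only [Set.mem_ofPred_eq] at hW ⊢
  rw [integral_div, ← Finset.sum_div, le_div_iff₀ hqp]
  calc _ = (k:ℝ) * (∫ r, Y r ∂ν + τ * q) := by field_simp
    _ ≤ _ := hW.le

/-- squared norm -/
def nsq {n : ℕ} (v : Fin n → ℝ) : ℝ := ∑ i, v i ^ 2

lemma nsq_nonneg {n : ℕ} (v : Fin n → ℝ) : 0 ≤ nsq v := Finset.sum_nonneg fun _ _ => sq_nonneg _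

lemma nsq_eq_zero {n : ℕ} {v : Fin n → ℝ} (h : nsq v = 0) : ∀ i, v i = 0 := by
  intro i
  have := (Finset.sum_eq_zero_iff_of_nonneg (fun i _ => sq_nonneg (v i))).1 h i (Finset.mem_univ i)
  exact pow_eq_zero_iff (two_ne_zero) |>.1 this

/-- variance of a row functional -/
def rowq {b : ℕ} (s : NNReal) (u : Fin b → ℝ) : NNReal := s * ⟨nsq u, nsq_nonneg u⟩

lemma rowq_coe {b : ℕ} (s : NNReal) (u : Fin b → ℝ) : (rowq s u : ℝ) = s * nsq u := rfl

lemma row_law' {b : ℕ} (s : NNReal) (u : Fin b → ℝ) :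
    (rowM b s).map (fun r => ∑ j, r j * u j) = gaussianReal 0 (rowq s u) :=
  row_law s u _ rfl

lemma rowq_zero {b : ℕ} {s : NNReal} (hs : s ≠ 0) {u : Fin b → ℝ} (h : rowq s u = 0) : ∀ i, u i = 0 := by
  apply nsq_eq_zero
  have : (rowq s u : ℝ) = 0 := by rw [h]; rfl
  rw [rowq_coe] at this
  rcases mul_eq_zero.1 this with h | h
  · exact absurd (by exact_mod_cast h) hs
  · exact h

lemma row_sq_int {b : ℕ} (s : NNReal) (u : Fin b → ℝ) :
    Integrable (fun r : Fin b → ℝ => (∑ j, r j * u j)^2) (rowM b s) :=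
  ((row_gauss s u u).fst.memLp_two).integrable_sq

lemma row_sq {b : ℕ} (s : NNReal) (u : Fin b → ℝ) :
    ∫ r, (∑ j, r j * u j)^2 ∂(rowM b s) = s * nsq u := by
  have h := row_cov s u u
  rw [covariance_self (Measurable.aemeasurable (by fun_prop)),
    variance_of_integral_eq_zero (Measurable.aemeasurable (by fun_prop)) (row_mean s u)] at h
  rw [h]; unfold nsq; congr 1; exact Finset.sum_congr rfl fun i _ => by ring

lemma row_neg_int {b : ℕ} (s : NNReal) (f : (Fin b → ℝ) → ℝ) (hf : Measurable f) :
    ∫ r, f (fun j => - r j) ∂(rowM b s) = ∫ r, f r ∂(rowM b s) := by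
  have h := (row_neg (b := b) s)
  conv_rhs => rw [← h.map_eq]
  rw [integral_map h.measurable.aemeasurable hf.aestronglyMeasurable]

lemma dot_neg {b : ℕ} (r u : Fin b → ℝ) : ∑ j, (- r j) * u j = - ∑ j, r j * u j := by
  rw [← Finset.sum_neg_distrib]; exact Finset.sum_congr rfl fun i _ => by ring

lemma mean_relu {b : ℕ} (s : NNReal) (u : Fin b → ℝ) :
    ∫ r, (max (∑ j, r j * u j) 0)^2 ∂(rowM b s) = s * nsq u / 2 := by
  have h1 := row_neg_int s (fun r => (max (∑ j, r j * u j) 0)^2) (by fun_prop)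
  simp only [dot_neg] at h1
  have i1 : Integrable (fun r : Fin b → ℝ => (max (∑ j, r j * u j) 0)^2) (rowM b s) := by
    refine (row_sq_int s u).mono' (Measurable.aestronglyMeasurable (by fun_prop)) (Filter.Eventually.of_forall fun r => ?_)
    rw [Real.norm_eq_abs, abs_of_nonneg (sq_nonneg _)]
    rcases max_cases (∑ j, r j * u j) 0 with h | h <;> rw [h.1]
    nlinarith [sq_nonneg (∑ j, r j * u j)]
  have i2 : Integrable (fun r : Fin b → ℝ => (max (-∑ j, r j * u j) 0)^2) (rowM b s) := by
    refine (row_sq_int s u).mono' (Measurable.aestronglyMeasurable (by fun_prop)) (Filter.Eventually.of_forall fun r => ?_)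
    rw [Real.norm_eq_abs, abs_of_nonneg (sq_nonneg _)]
    rcases max_cases (-∑ j, r j * u j) 0 with h | h <;> rw [h.1]
    · rw [neg_sq]
    · nlinarith [sq_nonneg (∑ j, r j * u j)]
  have h2 : ∫ r, (max (∑ j, r j * u j) 0)^2 + (max (-∑ j, r j * u j) 0)^2 ∂(rowM b s) = s * nsq u := by
    rw [← row_sq]
    congr 1; ext r
    rcases max_cases (∑ j, r j * u j) 0 with h | h <;> rcases max_cases (-∑ j, r j * u j) 0 with h' | h' <;>
      rw [h.1, h'.1] <;> nlinarith
  rw [integral_add i1 i2, h1] at h2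
  linarith

/-- tail and small ball constants -/
def kap1 : ℝ := (gaussianReal 0 1).real {x | 2 ≤ |x|}
def kap2 : ℝ := gaussianPDFReal 0 1 1
def c0 : ℝ := min (3 * kap1 * kap2 / 8) (1/12)

lemma kap2_pos : 0 < kap2 := gaussianPDFReal_pos _ _ _ one_ne_zero

lemma kap1_pos : 0 < kap1 := by
  unfold kap1
  rw [measureReal_def, ENNReal.toReal_pos_iff]
  refine ⟨?_, measure_lt_top _ _⟩
  rw [pos_iff_ne_zero]
  intro h
  have h2 := gaussianReal_absolutelyContinuous' 0 (v := 1) one_ne_zero h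
  have h3 : volume (Set.Icc (2:ℝ) 3) = 0 := measure_mono_null (fun x hx => by
    simp only [Set.mem_Icc, Set.mem_ofPred_eq] at *
    exact hx.1.trans (le_abs_self x)) h2
  rw [Real.volume_Icc] at h3
  norm_num at h3

lemma c0_pos : 0 < c0 := by
  have := kap1_pos
  have := kap2_pos
  unfold c0; positivity

lemma gauss_std (q : NNReal) : gaussianReal 0 q = (gaussianReal 0 1).map (fun x => Real.sqrt q * x) := by
  rw [gaussianReal_map_const_mul]
  congr 1
  · simp
  · apply NNReal.eq; simp [Real.sq_sqrt]

lemma small_ball_lower (n : ℝ) (h0 : 0 ≤ n) (h1 : n ≤ 1) :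
    kap2 * n ≤ (gaussianReal 0 1).real {x | |x| ≤ n} := by
  rw [measureReal_def, gaussianReal_apply_eq_integral 0 one_ne_zero, ENNReal.toReal_ofReal
    (integral_nonneg fun x => gaussianPDFReal_nonneg _ _ _)]
  have hset : {x : ℝ | |x| ≤ n} = Set.Icc (-n) n := by ext x; simp [abs_le]
  rw [hset]
  have : ∫ x in Set.Icc (-n) n, kap2 ≤ ∫ x in Set.Icc (-n) n, gaussianPDFReal 0 1 x := by
    apply setIntegral_mono_on (by simp) (integrable_gaussianPDFReal 0 1).integrableOn measurableSet_Icc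
    intro x hx
    unfold kap2 gaussianPDFReal
    have h2 : |x| ≤ 1 := (abs_le.2 ⟨hx.1, hx.2⟩).trans h1
    have h3 := sq_le_one_iff_abs_le_one x |>.2 h2
    apply mul_le_mul_of_nonneg_left _ (by positivity)
    apply Real.exp_le_exp.2
    simp only [sub_zero, NNReal.coe_one, mul_one]
    linarith
  refine le_trans ?_ this
  simp [Real.volume_real_Icc]
  rw [max_eq_left (by linarith)]
  nlinarith [kap2_pos]

lemma small_ball_upper (n : ℝ) (h0 : 0 ≤ n) :
    (gaussianReal 0 1) {x | |x| ≤ n} ≤ ENNReal.ofReal n := by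
  rw [gaussianReal_apply_eq_integral 0 one_ne_zero]
  apply ENNReal.ofReal_le_ofReal
  have hset : {x : ℝ | |x| ≤ n} = Set.Icc (-n) n := by ext x; simp [abs_le]
  rw [hset]
  have : ∫ x in Set.Icc (-n) n, gaussianPDFReal 0 1 x ≤ ∫ x in Set.Icc (-n) n, (1/2:ℝ) := by
    apply setIntegral_mono_on (integrable_gaussianPDFReal 0 1).integrableOn (by simp) measurableSet_Icc
    intro x hx
    unfold gaussianPDFReal
    have hpi : 2 ≤ Real.sqrt (2 * Real.pi) := by
      apply Real.le_sqrt_of_sq_le; linarith [Real.pi_gt_three]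
    have h1 : (Real.sqrt (2 * Real.pi * (1:NNReal)))⁻¹ ≤ 1/2 := by
      rw [one_div]; apply inv_anti₀ (by norm_num); simpa using hpi
    have h2 : Real.exp (-(x - 0)^2 / (2 * (1:NNReal))) ≤ 1 := Real.exp_le_one_iff.2 (by
      apply div_nonpos_of_nonpos_of_nonneg <;> simp; positivity)
    calc _ ≤ (1/2:ℝ) * 1 := by gcongr
      _ = 1/2 := by norm_num
  refine this.trans ?_
  simp [Real.volume_real_Icc]
  rw [max_eq_left (by linarith)]
  linarith

/-- the key negative-part bound -/
lemma neg_part_lower {b : ℕ} (s : NNReal) (hs : s ≠ 0) (m n : Fin b → ℝ) (hmn : ∑ j, m j * n j = 0)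
    (hm : nsq m ≤ 1) (hn : nsq n ≤ 1) :
    s * (3 * kap1 * kap2) * (Real.sqrt (nsq n))^3 ≤
      ∫ r, max ((∑ j, r j * n j)^2 - (∑ j, r j * m j)^2) 0 ∂(rowM b s) := by
  have hsp : (0:ℝ) < s := by positivity
  set N := Real.sqrt (nsq n) with hN
  have hN0 : 0 ≤ N := Real.sqrt_nonneg _
  have hN2 : N^2 = nsq n := Real.sq_sqrt (nsq_nonneg n)
  have hN1 : N ≤ 1 := by rw [hN]; exact Real.sqrt_le_one.2 hn
  set S := Real.sqrt s with hS
  have hSp : 0 < S := Real.sqrt_pos.2 hsp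
  have hS2 : S^2 = s := Real.sq_sqrt hsp.le
  set A := {r : Fin b → ℝ | 2 * (S * N) ≤ |∑ j, r j * n j|} with hA
  set B := {r : Fin b → ℝ | |∑ j, r j * m j| ≤ S * N} with hB
  have mA : MeasurableSet A := measurableSet_le (by fun_prop) (by fun_prop)
  have mB : MeasurableSet B := measurableSet_le (by fun_prop) (by fun_prop)
  have hAB : (rowM b s).real (A ∩ B) = (rowM b s).real A * (rowM b s).real B := by
    have hi := row_indep s n m (by rw [← hmn]; exact Finset.sum_congr rfl fun i _ => mul_comm _ _)
    have := hi.measure_inter_preimage_eq_mul {x | 2 * (S * N) ≤ |x|} {x | |x| ≤ S * N}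
      (measurableSet_le (by fun_prop) (by fun_prop)) (measurableSet_le (by fun_prop) (by fun_prop))
    simp only [measureReal_def, ← ENNReal.toReal_mul]
    congr 1
  have sq1 : Real.sqrt (rowq s n) = S * N := by rw [rowq_coe, Real.sqrt_mul hsp.le]
  have sq2 : Real.sqrt (rowq s m) = S * Real.sqrt (nsq m) := by rw [rowq_coe, Real.sqrt_mul hsp.le]
  have pA : kap1 ≤ (rowM b s).real A := by
    have h1 : (rowM b s).real A = (gaussianReal 0 (rowq s n)).real {x | 2 * (S * N) ≤ |x|} := by
      rw [← row_law', map_measureReal_apply (by fun_prop) (measurableSet_le (by fun_prop) (by fun_prop))]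
      rfl
    rw [h1, gauss_std, map_measureReal_apply (by fun_prop) (measurableSet_le (by fun_prop) (by fun_prop)), sq1]
    unfold kap1
    apply measureReal_mono _ (measure_ne_top _ _)
    intro x hx
    simp only [Set.mem_preimage, Set.mem_ofPred_eq, abs_mul, abs_of_pos hSp, abs_of_nonneg hN0] at hx ⊢
    nlinarith [mul_nonneg hSp.le hN0]
  have pB : kap2 * N ≤ (rowM b s).real B := by
    have h1 : (rowM b s).real B = (gaussianReal 0 (rowq s m)).real {x | |x| ≤ S * N} := by
      rw [← row_law', map_measureReal_apply (by fun_prop) (measurableSet_le (by fun_prop) (by fun_prop))]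
      rfl
    rw [h1, gauss_std, map_measureReal_apply (by fun_prop) (measurableSet_le (by fun_prop) (by fun_prop)), sq2]
    refine (small_ball_lower N hN0 hN1).trans ?_
    apply measureReal_mono _ (measure_ne_top _ _)
    intro x hx
    have hM : Real.sqrt (nsq m) ≤ 1 := Real.sqrt_le_one.2 hm
    simp only [Set.mem_preimage, Set.mem_ofPred_eq, abs_mul, abs_of_pos hSp, abs_of_nonneg (Real.sqrt_nonneg _)] at hx ⊢
    rw [mul_assoc]
    apply mul_le_mul_of_nonneg_left _ hSp.le
    nlinarith [abs_nonneg x]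
  have hInt0 : Integrable (fun r : Fin b → ℝ => max ((∑ j, r j * n j)^2 - (∑ j, r j * m j)^2) 0) (rowM b s) :=
    ((row_sq_int s n).sub (row_sq_int s m)).pos_part
  have hlow : ∀ r, (A ∩ B).indicator (fun _ => 3 * (S*N)^2) r ≤ max ((∑ j, r j * n j)^2 - (∑ j, r j * m j)^2) 0 := by
    intro r
    by_cases hr : r ∈ A ∩ B
    · rw [Set.indicator_of_mem hr]
      refine le_trans ?_ (le_max_left _ _)
      have ha : 2 * (S * N) ≤ |∑ j, r j * n j| := hr.1
      have hb : |∑ j, r j * m j| ≤ S * N := hr.2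
      rw [← sq_abs (∑ j, r j * n j), ← sq_abs (∑ j, r j * m j)]
      nlinarith [abs_nonneg (∑ j, r j * m j), mul_nonneg hSp.le hN0]
    · rw [Set.indicator_of_notMem hr]; exact le_max_right _ _
  have := integral_mono ((integrable_const (3*(S*N)^2)).indicator (mA.inter mB)) hInt0 hlow
  rw [integral_indicator_const _ (mA.inter mB), hAB, smul_eq_mul] at this
  refine le_trans ?_ this
  have k1 := kap1_pos
  have k2 := kap2_pos
  calc s * (3 * kap1 * kap2) * N^3 = (kap1 * (kap2 * N)) * (3 * (S*N)^2) := by rw [mul_pow, hS2]; ring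
    _ ≤ _ := by gcongr

lemma relu_sub_sq (a b : ℝ) : (max a 0 - max b 0)^2 ≤ (a-b)^2 := by
  rw [sq_le_sq]; exact abs_max_sub_max_le_abs a b 0

lemma relu_sub_sq_add (a b : ℝ) : (max a 0 - max b 0)^2 + (max (-a) 0 - max (-b) 0)^2 =
    (a-b)^2 - 2 * max (((a-b)/2)^2 - ((a+b)/2)^2) 0 := by
  have : ((a-b)/2)^2 - ((a+b)/2)^2 = - (a*b) := by ring
  rw [this]
  rcases le_total 0 a with ha | ha <;> rcases le_total 0 b with hb | hb
  · rw [max_eq_left ha, max_eq_left hb, max_eq_right (by linarith), max_eq_right (by linarith), max_eq_right (by nlinarith)]; ring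
  · rw [max_eq_left ha, max_eq_right hb, max_eq_right (by linarith), max_eq_left (by linarith), max_eq_left (by nlinarith)]; ring
  · rw [max_eq_right ha, max_eq_left hb, max_eq_left (by linarith), max_eq_right (by linarith), max_eq_left (by nlinarith)]; ring
  · rw [max_eq_right ha, max_eq_right hb, max_eq_left (by linarith), max_eq_left (by linarith), max_eq_right (by nlinarith)]; ring

lemma dot_sub {b : ℕ} (r u v : Fin b → ℝ) : ∑ j, r j * (u j - v j) = ∑ j, r j * u j - ∑ j, r j * v j := by
  rw [← Finset.sum_sub_distrib]; exact Finset.sum_congr rfl fun i _ => by ring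

lemma mean_diff {b : ℕ} (s : NNReal) (hs : s ≠ 0) (u v : Fin b → ℝ) (hu : nsq u = 1) (hv : nsq v = 1) :
    ∫ r, (max (∑ j, r j * u j) 0 - max (∑ j, r j * v j) 0)^2 ∂(rowM b s) ≤
      s * (nsq (fun j => u j - v j) / 2 - c0 * (Real.sqrt (nsq (fun j => u j - v j)))^3) := by
  have h1 := row_neg_int s (fun r => (max (∑ j, r j * u j) 0 - max (∑ j, r j * v j) 0)^2) (by fun_prop)
  simp only [dot_neg] at h1
  have i0 := row_sq_int s (fun j => u j - v j)
  have i1 : Integrable (fun r : Fin b → ℝ => (max (∑ j, r j * u j) 0 - max (∑ j, r j * v j) 0)^2) (rowM b s) := by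
    refine i0.mono' (Measurable.aestronglyMeasurable (by fun_prop)) (Filter.Eventually.of_forall fun r => ?_)
    rw [Real.norm_eq_abs, abs_of_nonneg (sq_nonneg _), dot_sub]
    exact relu_sub_sq _ _
  have i2 : Integrable (fun r : Fin b → ℝ => (max (-∑ j, r j * u j) 0 - max (-∑ j, r j * v j) 0)^2) (rowM b s) := by
    refine i0.mono' (Measurable.aestronglyMeasurable (by fun_prop)) (Filter.Eventually.of_forall fun r => ?_)
    rw [Real.norm_eq_abs, abs_of_nonneg (sq_nonneg _), dot_sub]
    refine (relu_sub_sq _ _).trans (le_of_eq ?_)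
    ring
  set m : Fin b → ℝ := fun j => (u j + v j)/2 with hm
  set n : Fin b → ℝ := fun j => (u j - v j)/2 with hn
  have i3 : Integrable (fun r : Fin b → ℝ => max ((∑ j, r j * n j)^2 - (∑ j, r j * m j)^2) 0) (rowM b s) :=
    ((row_sq_int s n).sub (row_sq_int s m)).pos_part
  have en : ∀ r : Fin b → ℝ, ∑ j, r j * n j = (∑ j, r j * u j - ∑ j, r j * v j)/2 := by
    intro r; rw [← dot_sub, Finset.sum_div]; exact Finset.sum_congr rfl fun i _ => by simp only [hn]; ring
  have em : ∀ r : Fin b → ℝ, ∑ j, r j * m j = (∑ j, r j * u j + ∑ j, r j * v j)/2 := by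
    intro r; rw [← Finset.sum_add_distrib, Finset.sum_div]; exact Finset.sum_congr rfl fun i _ => by simp only [hm]; ring
  have h2 : ∫ r, (max (∑ j, r j * u j) 0 - max (∑ j, r j * v j) 0)^2 +
      (max (-∑ j, r j * u j) 0 - max (-∑ j, r j * v j) 0)^2 ∂(rowM b s) =
      s * nsq (fun j => u j - v j) - 2 * ∫ r, max ((∑ j, r j * n j)^2 - (∑ j, r j * m j)^2) 0 ∂(rowM b s) := by
    rw [← row_sq, ← integral_const_mul, ← integral_sub i0 (i3.const_mul 2)]
    congr 1; ext r
    rw [relu_sub_sq_add, en, em, dot_sub]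
  rw [integral_add i1 i2, h1] at h2
  have horth : ∑ j, m j * n j = 0 := by
    have : ∑ j, m j * n j = (nsq u - nsq v)/4 := by
      unfold nsq
      rw [← Finset.sum_sub_distrib, Finset.sum_div]; exact Finset.sum_congr rfl fun i _ => by simp only [hm, hn]; ring
    rw [this, hu, hv]; norm_num
  have hpar : nsq m + nsq n = 1 := by
    have : nsq m + nsq n = (nsq u + nsq v)/2 := by
      unfold nsq
      rw [← Finset.sum_add_distrib, ← Finset.sum_add_distrib, Finset.sum_div]; exact Finset.sum_congr rfl fun i _ => by simp only [hm, hn]; ring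
    rw [this, hu, hv]; norm_num
  have hk := neg_part_lower s hs m n horth (by linarith [nsq_nonneg n]) (by linarith [nsq_nonneg m])
  have hnn : nsq n = nsq (fun j => u j - v j) / 4 := by
    unfold nsq; rw [Finset.sum_div]; exact Finset.sum_congr rfl fun i _ => by simp only [hn]; ring
  have hsq : Real.sqrt (nsq n) = Real.sqrt (nsq (fun j => u j - v j)) / 2 := by
    rw [hnn, Real.sqrt_div (nsq_nonneg _)]; congr 1
    rw [show (4:ℝ) = 2^2 by norm_num, Real.sqrt_sq (by norm_num)]
  rw [hsq] at hk
  set D := Real.sqrt (nsq (fun j => u j - v j))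
  have hD : 0 ≤ D := Real.sqrt_nonneg _
  have hc : c0 ≤ 3 * kap1 * kap2 / 8 := min_le_left _ _
  have hs0 : (0:ℝ) ≤ s := s.2
  have : (s:ℝ) * (c0 * D^3) ≤ s * (3 * kap1 * kap2) * (D/2)^3 := by
    calc (s:ℝ) * (c0 * D^3) ≤ s * ((3 * kap1 * kap2 / 8) * D^3) := by gcongr
      _ = _ := by ring
  linarith

/-- one layer -/
def lay {a b : ℕ} (W : Fin a → Fin b → ℝ) (u : Fin b → ℝ) : Fin a → ℝ := fun j => max (∑ i, W j i * u i) 0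

def pf (k : ℕ) (τ : ℝ) : ENNReal := ENNReal.ofReal (Real.exp (Kc - Real.sqrt k * τ))

lemma meas_dot {b : ℕ} (u : Fin b → ℝ) : Measurable (fun r : Fin b → ℝ => ∑ j, r j * u j) := by fun_prop

lemma layer_upper {k b : ℕ} (s : NNReal) (hs : s ≠ 0) (hk : 64 ≤ k) (u : Fin b → ℝ) (τ : ℝ) :
    gaussMat k b s {W | k * s * nsq u * (1/2 + τ) < nsq (lay W u)} ≤ pf k τ := by
  have h := conc_scaled (rowM b s) (fun r => (max (∑ j, r j * u j) 0)^2) (fun r => ∑ j, r j * u j)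
    (by fun_prop) (by fun_prop) (rowq s u) (row_law' s u) (fun r => by
      rw [abs_of_nonneg (sq_nonneg _)]
      rcases max_cases (∑ j, r j * u j) 0 with h | h <;> rw [h.1]
      nlinarith [sq_nonneg (∑ j, r j * u j)]) (fun h r => by
      have := rowq_zero hs h
      simp [this]) k hk τ
  rw [mean_relu, rowq_coe] at h
  refine le_trans (measure_mono fun W hW => ?_) h
  simp only [Set.mem_ofPred_eq] at hW ⊢
  refine lt_of_eq_of_lt ?_ hW
  ring

lemma layer_lower {k b : ℕ} (s : NNReal) (hs : s ≠ 0) (hk : 64 ≤ k) (u : Fin b → ℝ) (τ : ℝ) :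
    gaussMat k b s {W | nsq (lay W u) < k * s * nsq u * (1/2 - τ)} ≤ pf k τ := by
  have h := conc_scaled (rowM b s) (fun r => - (max (∑ j, r j * u j) 0)^2) (fun r => ∑ j, r j * u j)
    (by fun_prop) (by fun_prop) (rowq s u) (row_law' s u) (fun r => by
      rw [abs_neg, abs_of_nonneg (sq_nonneg _)]
      rcases max_cases (∑ j, r j * u j) 0 with h | h <;> rw [h.1]
      nlinarith [sq_nonneg (∑ j, r j * u j)]) (fun h r => by
      have := rowq_zero hs h
      simp [this]) k hk τ
  rw [integral_neg, mean_relu, rowq_coe] at h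
  refine le_trans (measure_mono fun W hW => ?_) h
  simp only [Set.mem_ofPred_eq] at hW ⊢
  rw [Finset.sum_neg_distrib]
  have : nsq (lay W u) = ∑ j, (max (∑ i, W j i * u i) 0)^2 := rfl
  rw [← this]
  linarith

lemma layer_lin {k b : ℕ} (s : NNReal) (hs : s ≠ 0) (hk : 64 ≤ k) (u : Fin b → ℝ) (τ : ℝ) :
    gaussMat k b s {W | k * s * nsq u * (1 + τ) < nsq (fun j => ∑ i, W j i * u i)} ≤ pf k τ := by
  have h := conc_scaled (rowM b s) (fun r => (∑ j, r j * u j)^2) (fun r => ∑ j, r j * u j)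
    (by fun_prop) (by fun_prop) (rowq s u) (row_law' s u) (fun r => by
      rw [abs_of_nonneg (sq_nonneg _)]) (fun h r => by
      have := rowq_zero hs h
      simp [this]) k hk τ
  rw [row_sq, rowq_coe] at h
  refine le_trans (measure_mono fun W hW => ?_) h
  simp only [Set.mem_ofPred_eq] at hW ⊢
  refine lt_of_eq_of_lt ?_ hW
  ring

lemma layer_diff {k b : ℕ} (s : NNReal) (hs : s ≠ 0) (hk : 64 ≤ k) (u v : Fin b → ℝ) (τ : ℝ)
    (hu : nsq u = 1) (hv : nsq v = 1) :
    gaussMat k b s {W | k * s * (nsq (fun j => u j - v j) * (1/2 + τ) -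
      c0 * (Real.sqrt (nsq (fun j => u j - v j)))^3) < nsq (fun j => lay W u j - lay W v j)} ≤ pf k τ := by
  have h := conc_scaled (rowM b s) (fun r => (max (∑ j, r j * u j) 0 - max (∑ j, r j * v j) 0)^2)
    (fun r => ∑ j, r j * (u j - v j))
    (by fun_prop) (by fun_prop) (rowq s (fun j => u j - v j)) (row_law' s _) (fun r => by
      rw [abs_of_nonneg (sq_nonneg _), dot_sub]; exact relu_sub_sq _ _) (fun h r => by
      have h2 := rowq_zero hs h
      have : u = v := by ext i; linarith [h2 i]
      simp [this]) k hk τ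
  refine le_trans (measure_mono fun W hW => ?_) h
  have hm := mean_diff s hs u v hu hv
  simp only [Set.mem_ofPred_eq] at hW ⊢
  refine lt_of_le_of_lt ?_ hW
  rw [rowq_coe, mul_assoc]
  apply mul_le_mul_of_nonneg_left _ (Nat.cast_nonneg k)
  linarith

/-- normalisation -/
def nrmz {n : ℕ} (u : Fin n → ℝ) : Fin n → ℝ := fun j => u j / Real.sqrt (nsq u)

lemma nsq_nrmz {n : ℕ} {u : Fin n → ℝ} (h : nsq u ≠ 0) : nsq (nrmz u) = 1 := by
  have : nsq (nrmz u) = nsq u / Real.sqrt (nsq u)^2 := by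
    unfold nrmz; conv_lhs => unfold nsq
    simp only [div_pow]
    rw [← Finset.sum_div]; rfl
  rw [this, Real.sq_sqrt (nsq_nonneg u), div_self h]

/-- good event for a layer and a pair of vectors -/
def GoodL {k b : ℕ} (s τ : ℝ) (W : Fin k → Fin b → ℝ) (u v : Fin b → ℝ) : Prop :=
  ((nsq (lay W u) ≤ k * s * nsq u * (1/2 + τ) ∧ k * s * nsq u * (1/2 - τ) ≤ nsq (lay W u)) ∧
  (nsq (lay W v) ≤ k * s * nsq v * (1/2 + τ) ∧ k * s * nsq v * (1/2 - τ) ≤ nsq (lay W v))) ∧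
  nsq (fun j => ∑ i, W j i * (u i - v i)) ≤ k * s * nsq (fun i => u i - v i) * (1 + 1) ∧
  (nsq u = 0 ∨ nsq v = 0 ∨ nsq (fun j => lay W (nrmz u) j - lay W (nrmz v) j) ≤
    k * s * (nsq (fun j => nrmz u j - nrmz v j) * (1/2 + τ) -
      c0 * (Real.sqrt (nsq (fun j => nrmz u j - nrmz v j)))^3))

lemma pf_anti {k : ℕ} {τ : ℝ} (h : τ ≤ 1) : pf k 1 ≤ pf k τ := by
  unfold pf
  apply ENNReal.ofReal_le_ofReal
  apply Real.exp_le_exp.2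
  have := Real.sqrt_nonneg (k:ℝ)
  nlinarith

lemma good_layer {k b : ℕ} (s : NNReal) (hs : s ≠ 0) (hk : 64 ≤ k) (τ : ℝ) (hτ : τ ≤ 1) (u v : Fin b → ℝ) :
    gaussMat k b s {W | ¬ GoodL s τ W u v} ≤ 6 * pf k τ := by
  set S1 := {W : Fin k → Fin b → ℝ | k * s * nsq u * (1/2 + τ) < nsq (lay W u)}
  set S2 := {W : Fin k → Fin b → ℝ | nsq (lay W u) < k * s * nsq u * (1/2 - τ)}
  set S3 := {W : Fin k → Fin b → ℝ | k * s * nsq v * (1/2 + τ) < nsq (lay W v)}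
  set S4 := {W : Fin k → Fin b → ℝ | nsq (lay W v) < k * s * nsq v * (1/2 - τ)}
  set S5 := {W : Fin k → Fin b → ℝ | k * s * nsq (fun i => u i - v i) * (1 + 1) < nsq (fun j => ∑ i, W j i * (u i - v i))}
  set S6 := {W : Fin k → Fin b → ℝ | ¬ (nsq u = 0 ∨ nsq v = 0 ∨ nsq (fun j => lay W (nrmz u) j - lay W (nrmz v) j) ≤
    k * s * (nsq (fun j => nrmz u j - nrmz v j) * (1/2 + τ) -
      c0 * (Real.sqrt (nsq (fun j => nrmz u j - nrmz v j)))^3))}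
  have h6 : gaussMat k b s S6 ≤ pf k τ := by
    by_cases hu : nsq u = 0
    · simp [S6, hu]
    by_cases hv : nsq v = 0
    · simp [S6, hv]
    refine le_trans (measure_mono fun W hW => ?_) (layer_diff s hs hk (nrmz u) (nrmz v) τ (nsq_nrmz hu) (nsq_nrmz hv))
    simp only [S6, Set.mem_ofPred_eq, not_or, not_le] at hW ⊢
    exact hW.2.2
  have hsub : {W | ¬ GoodL s τ W u v} ⊆ S1 ∪ S2 ∪ S3 ∪ S4 ∪ S5 ∪ S6 := by
    intro W hW
    by_contra hc
    simp only [Set.mem_union, not_or, S1, S2, S3, S4, S5, S6, Set.mem_ofPred_eq, not_lt] at hc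
    obtain ⟨⟨⟨⟨⟨h1, h2⟩, h3⟩, h4⟩, h5⟩, h6⟩ := hc
    exact hW ⟨⟨⟨h1, h2⟩, h3, h4⟩, h5, by tauto⟩
  calc gaussMat k b s {W | ¬ GoodL s τ W u v} ≤ gaussMat k b s (S1 ∪ S2 ∪ S3 ∪ S4 ∪ S5 ∪ S6) := measure_mono hsub
    _ ≤ gaussMat k b s S1 + gaussMat k b s S2 + gaussMat k b s S3 + gaussMat k b s S4 + gaussMat k b s S5 + gaussMat k b s S6 := by
      refine (measure_union_le _ _).trans (add_le_add ?_ le_rfl)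
      refine (measure_union_le _ _).trans (add_le_add ?_ le_rfl)
      refine (measure_union_le _ _).trans (add_le_add ?_ le_rfl)
      refine (measure_union_le _ _).trans (add_le_add ?_ le_rfl)
      exact (measure_union_le _ _)
    _ ≤ pf k τ + pf k τ + pf k τ + pf k τ + pf k τ + pf k τ := by
      gcongr
      · exact layer_upper s hs hk u τ
      · exact layer_lower s hs hk u τ
      · exact layer_upper s hs hk v τ
      · exact layer_lower s hs hk v τ
      · exact (layer_lin s hs hk (fun i => u i - v i) 1).trans (pf_anti hτ)
    _ = 6 * pf k τ := by ring

lemma meas_nsq {n : ℕ} : Measurable (nsq : (Fin n → ℝ) → ℝ) := by unfold nsq; fun_prop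

lemma meas_good {Ω : Type*} [MeasurableSpace Ω] {k b : ℕ} (s τ : ℝ) (W : Ω → Fin k → Fin b → ℝ) (u v : Ω → Fin b → ℝ)
    (hW : Measurable W) (hu : Measurable u) (hv : Measurable v) :
    MeasurableSet {ω | ¬ GoodL s τ (W ω) (u ω) (v ω)} := by
  have hwj : ∀ j i, Measurable fun ω => W ω j i := fun j i => (measurable_pi_apply i).comp ((measurable_pi_apply j).comp hW)
  have hui : ∀ i, Measurable fun ω => u ω i := fun i => (measurable_pi_apply i).comp hu
  have hvi : ∀ i, Measurable fun ω => v ω i := fun i => (measurable_pi_apply i).comp hv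
  have mn : ∀ {n : ℕ} (x : Ω → Fin n → ℝ), (∀ i, Measurable fun ω => x ω i) → Measurable fun ω => nsq (x ω) := by
    intro n x hx; unfold nsq; fun_prop
  have ml : ∀ (x : Ω → Fin b → ℝ), (∀ i, Measurable fun ω => x ω i) → ∀ j, Measurable fun ω => lay (W ω) (x ω) j := by
    intro x hx j; unfold lay; fun_prop
  have mz : ∀ (x : Ω → Fin b → ℝ), (∀ i, Measurable fun ω => x ω i) → ∀ j, Measurable fun ω => nrmz (x ω) j := by
    intro x hx j; unfold nrmz; have := mn x hx; fun_prop
  have m1 := mn u hui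
  have m2 := mn v hvi
  have m3 := mn _ (ml u hui)
  have m4 := mn _ (ml v hvi)
  have m5 : Measurable fun ω => nsq (fun j => ∑ i, W ω j i * (u ω i - v ω i)) := mn _ (by fun_prop)
  have m6 : Measurable fun ω => nsq (fun i => u ω i - v ω i) := mn _ (by fun_prop)
  have m7 : Measurable fun ω => nsq (fun j => nrmz (u ω) j - nrmz (v ω) j) :=
    mn (fun ω j => nrmz (u ω) j - nrmz (v ω) j) (fun i => (mz u hui i).sub (mz v hvi i))
  have m8 : Measurable fun ω => nsq (fun j => lay (W ω) (nrmz (u ω)) j - lay (W ω) (nrmz (v ω)) j) :=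
    mn (fun ω j => lay (W ω) (nrmz (u ω)) j - lay (W ω) (nrmz (v ω)) j)
      (fun i => (ml _ (mz u hui) i).sub (ml _ (mz v hvi) i))
  refine MeasurableSet.compl (s := {ω | GoodL s τ (W ω) (u ω) (v ω)}) ?_
  unfold GoodL
  simp only [Set.ofPred_and, Set.ofPred_or]
  refine ((MeasurableSet.inter ?_ ?_).inter (MeasurableSet.inter ?_ ?_)).inter (MeasurableSet.inter ?_
    (MeasurableSet.union ?_ (MeasurableSet.union ?_ ?_)))
  · exact measurableSet_le (by fun_prop) (by fun_prop)
  · exact measurableSet_le (by fun_prop) (by fun_prop)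
  · exact measurableSet_le (by fun_prop) (by fun_prop)
  · exact measurableSet_le (by fun_prop) (by fun_prop)
  · exact measurableSet_le (by fun_prop) (by fun_prop)
  · exact measurableSet_eq_fun m1 (by fun_prop)
  · exact measurableSet_eq_fun m2 (by fun_prop)
  · exact measurableSet_le (by fun_prop) (by fun_prop)

lemma pi_slice {ι : Type*} [Fintype ι] [DecidableEq ι] {X : ι → Type*} [∀ i, MeasurableSpace (X i)]
    (μ : ∀ i, Measure (X i)) [∀ i, IsProbabilityMeasure (μ i)] (S : Set (∀ i, X i)) (hS : MeasurableSet S)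
    (i : ι) (p : ENNReal) (h : ∀ w, μ i {z | Function.update w i z ∈ S} ≤ p) : Measure.pi μ S ≤ p := by
  have hm : Measurable (S.indicator (fun _ => (1:ENNReal))) := measurable_one.indicator hS
  have key : ∫⁻ w, S.indicator (fun _ => (1:ENNReal)) w ∂Measure.pi μ ≤ ∫⁻ w, (fun _ => p) w ∂Measure.pi μ := by
    apply lintegral_le_of_lmarginal_le {i} hm measurable_const
    intro w
    rw [lmarginal_singleton, lmarginal_singleton]
    simp only [lintegral_const, measure_univ, mul_one]
    have : (fun z => S.indicator (fun _ => (1:ENNReal)) (Function.update w i z)) =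
        ({z | Function.update w i z ∈ S}).indicator (fun _ => 1) := by
      ext z; simp [Set.indicator]
    rw [this]
    have hms : MeasurableSet {z | Function.update w i z ∈ S} := (measurable_update w) hS
    refine le_trans (le_of_eq (lintegral_indicator hms _)) ?_
    simpa using h w
  rw [lintegral_indicator hS] at key
  simpa using key

abbrev Wt (ℓ : ℕ) (D : ℕ → ℕ) := ∀ i : Fin ℓ, Fin (D (i.1+1)) → Fin (D i.1) → ℝ

/-- hidden-layer output -/
def hid {ℓ : ℕ} {D : ℕ → ℕ} (w : Wt ℓ D) (i : ℕ) (x : Fin (D 0) → ℝ) : Fin (D i) → ℝ :=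
  forward D (extendW ℓ D w) i x

lemma hid_succ {ℓ : ℕ} {D : ℕ → ℕ} (w : Wt ℓ D) (i : ℕ) (h : i < ℓ) (x : Fin (D 0) → ℝ) :
    hid w (i+1) x = lay (w ⟨i, h⟩) (hid w i x) := by
  unfold hid lay
  conv_lhs => unfold forward
  simp [extendW, h]

lemma hid_zero {ℓ : ℕ} {D : ℕ → ℕ} (w : Wt ℓ D) (x : Fin (D 0) → ℝ) : hid w 0 x = x := rfl

lemma hid_update {ℓ : ℕ} {D : ℕ → ℕ} (w : Wt ℓ D) (j : Fin ℓ) (z) (x : Fin (D 0) → ℝ) :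
    ∀ i : ℕ, i ≤ j.1 → hid (Function.update w j z) i x = hid w i x := by
  intro i
  induction i with
  | zero => intro _; rfl
  | succ i ih =>
    intro hi
    have hl : i < ℓ := by omega
    rw [hid_succ _ i hl, hid_succ _ i hl, ih (by omega), Function.update_of_ne]
    intro hc
    have := congrArg Fin.val hc
    simp at this; omega

lemma meas_hid {ℓ : ℕ} {D : ℕ → ℕ} (x : Fin (D 0) → ℝ) :
    ∀ i : ℕ, i ≤ ℓ → Measurable (fun w : Wt ℓ D => hid w i x) := by
  intro i
  induction i with
  | zero => intro _; exact measurable_const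
  | succ i ih =>
    intro hi
    have h2 := ih (by omega)
    have : (fun w : Wt ℓ D => hid w (i+1) x) = fun w => lay (w ⟨i, hi⟩) (hid w i x) := by
      ext1 w; exact hid_succ w i hi x
    rw [this]
    unfold lay
    have h3 : ∀ m, Measurable (fun w : Wt ℓ D => hid w i x m) := fun m => (measurable_pi_apply m).comp h2
    have h4 : ∀ j m, Measurable (fun w : Wt ℓ D => w ⟨i, hi⟩ j m) := fun j m => 
      (measurable_pi_apply m).comp ((measurable_pi_apply j).comp (measurable_pi_apply _))
    fun_prop

instance (ℓ : ℕ) (D : ℕ → ℕ) : IsProbabilityMeasure (hiddenMeasure ℓ D) := by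
  unfold hiddenMeasure; infer_instance

lemma pair_bad {ℓ : ℕ} {D : ℕ → ℕ} {k : ℕ} (hk : 64 ≤ k) (τ : ℝ) (hτ : τ ≤ 1) (j : Fin ℓ) (hD : D (j.1+1) = k)
    (hD0 : D j.1 ≠ 0) (x y : Fin (D 0) → ℝ) :
    hiddenMeasure ℓ D {w | ¬ GoodL (1 / (D j.1 : ℝ)) τ (w j) (hid w j.1 x) (hid w j.1 y)} ≤ 6 * pf k τ := by
  unfold hiddenMeasure
  apply pi_slice _ _ _ j
  · intro w
    simp only [Set.mem_ofPred_eq, Function.update_self, hid_update _ _ _ _ _ le_rfl]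
    have := good_layer (k := D (j.1+1)) (1 / (D j.1 : NNReal)) (by simpa using hD0) (by omega) τ hτ (hid w j.1 x) (hid w j.1 y)
    simpa [hD] using this
  · exact meas_good _ _ _ _ _ (measurable_pi_apply j) (meas_hid x _ j.2.le) (meas_hid y _ j.2.le)

lemma nsq_sub {n : ℕ} (a b : Fin n → ℝ) : nsq (fun j => a j - b j) = nsq a + nsq b - 2 * ∑ j, a j * b j := by
  unfold nsq
  rw [Finset.mul_sum, ← Finset.sum_add_distrib, ← Finset.sum_sub_distrib]
  exact Finset.sum_congr rfl fun j _ => by ring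

lemma nsq_smul {n : ℕ} (c : ℝ) (a : Fin n → ℝ) : nsq (fun j => c * a j) = c^2 * nsq a := by
  unfold nsq
  rw [Finset.mul_sum]
  exact Finset.sum_congr rfl fun j _ => by ring

lemma nrmz_mul {n : ℕ} {u : Fin n → ℝ} (hu : 0 < nsq u) : (fun j => Real.sqrt (nsq u) * nrmz u j) = u := by
  ext j
  unfold nrmz
  have := Real.sqrt_pos.2 hu
  field_simp

lemma nrmz_smul {n : ℕ} {u : Fin n → ℝ} {c : ℝ} (hc : 0 < c) : nrmz (fun j => c * u j) = nrmz u := by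
  ext j
  unfold nrmz
  rw [nsq_smul, Real.sqrt_mul (sq_nonneg c), Real.sqrt_sq hc.le, mul_div_mul_left _ _ hc.ne']

lemma lay_smul {a b : ℕ} (W : Fin a → Fin b → ℝ) (u : Fin b → ℝ) {c : ℝ} (hc : 0 ≤ c) :
    lay W (fun j => c * u j) = fun j => c * lay W u j := by
  ext j
  unfold lay
  rw [mul_max_of_nonneg _ _ hc, mul_zero, Finset.mul_sum]
  congr 1
  exact Finset.sum_congr rfl fun i _ => by ring

/-- relation of norms and normalised distance -/
lemma nsq_sub_eq {n : ℕ} {a b : Fin n → ℝ} (ha : 0 < nsq a) (hb : 0 < nsq b) :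
    nsq (fun j => a j - b j) = (Real.sqrt (nsq a) - Real.sqrt (nsq b))^2 +
      Real.sqrt (nsq a) * Real.sqrt (nsq b) * nsq (fun j => nrmz a j - nrmz b j) := by
  rw [nsq_sub, nsq_sub, nsq_nrmz ha.ne', nsq_nrmz hb.ne']
  have h1 := Real.sqrt_pos.2 ha
  have h2 := Real.sqrt_pos.2 hb
  have : ∑ j, nrmz a j * nrmz b j = (∑ j, a j * b j) / (Real.sqrt (nsq a) * Real.sqrt (nsq b)) := by
    unfold nrmz
    rw [Finset.sum_div]
    exact Finset.sum_congr rfl fun j _ => by field_simp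
  rw [this]
  have e1 := Real.sq_sqrt ha.le
  have e2 := Real.sq_sqrt hb.le
  field_simp
  nlinarith

lemma dist_le_four {n : ℕ} {a b : Fin n → ℝ} (ha : 0 < nsq a) (hb : 0 < nsq b) :
    nsq (fun j => nrmz a j - nrmz b j) ≤ 4 := by
  have h : nsq (fun j => nrmz a j - nrmz b j) ≤ 2 * nsq (nrmz a) + 2 * nsq (nrmz b) := by
    unfold nsq
    rw [Finset.mul_sum, Finset.mul_sum, ← Finset.sum_add_distrib]
    exact Finset.sum_le_sum fun j _ => by nlinarith [sq_nonneg (nrmz a j + nrmz b j)]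
  rw [nsq_nrmz ha.ne', nsq_nrmz hb.ne'] at h
  linarith

lemma step_dist {k b : ℕ} {s τ : ℝ} (W : Fin k → Fin b → ℝ) (u v : Fin b → ℝ) (hks : 0 < k * s)
    (hτ0 : 0 ≤ τ) (hτ : τ ≤ 1/8) (hu : 0 < nsq u) (hv : 0 < nsq v) (hg : GoodL s τ W u v) :
    nsq (fun j => nrmz (lay W u) j - nrmz (lay W v) j) ≤ nsq (fun j => nrmz u j - nrmz v j)
      - 2 * c0 * (Real.sqrt (nsq (fun j => nrmz u j - nrmz v j)))^3 + 16 * τ := by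
  obtain ⟨⟨⟨-, hlu⟩, -, hlv⟩, -, h4⟩ := hg
  have h4 : nsq (fun j => lay W (nrmz u) j - lay W (nrmz v) j) ≤
    k * s * (nsq (fun j => nrmz u j - nrmz v j) * (1/2 + τ) -
      c0 * (Real.sqrt (nsq (fun j => nrmz u j - nrmz v j)))^3) := by
    rcases h4 with h | h | h
    · exact absurd h hu.ne'
    · exact absurd h hv.ne'
    · exact h
  have eu : lay W u = fun j => Real.sqrt (nsq u) * lay W (nrmz u) j := by
    rw [← lay_smul W _ (Real.sqrt_nonneg _), nrmz_mul hu]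
  have ev : lay W v = fun j => Real.sqrt (nsq v) * lay W (nrmz v) j := by
    rw [← lay_smul W _ (Real.sqrt_nonneg _), nrmz_mul hv]
  have hsu := Real.sqrt_pos.2 hu
  have hsv := Real.sqrt_pos.2 hv
  rw [eu, nsq_smul, Real.sq_sqrt hu.le] at hlu
  rw [ev, nsq_smul, Real.sq_sqrt hv.le] at hlv
  rw [eu, ev, nrmz_smul hsu, nrmz_smul hsv]
  set a := lay W (nrmz u)
  set b' := lay W (nrmz v)
  set m := k * s * (1/2 - τ) with hm
  have hmp : 0 < m := mul_pos hks (by linarith)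
  have ha : m ≤ nsq a := by
    apply le_of_mul_le_mul_left _ hu
    calc nsq u * m = k * s * nsq u * (1/2 - τ) := by rw [hm]; ring
      _ ≤ _ := hlu
  have hb : m ≤ nsq b' := by
    apply le_of_mul_le_mul_left _ hv
    calc nsq v * m = k * s * nsq v * (1/2 - τ) := by rw [hm]; ring
      _ ≤ _ := hlv
  have hap := hmp.trans_le ha
  have hbp := hmp.trans_le hb
  have hE := nsq_sub_eq hap hbp
  have h4' := dist_le_four hap hbp
  have h4u := dist_le_four hu hv
  set X' := nsq (fun j => nrmz a j - nrmz b' j)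
  set X := nsq (fun j => nrmz u j - nrmz v j)
  have hX' : 0 ≤ X' := nsq_nonneg _
  have hprod : m ≤ Real.sqrt (nsq a) * Real.sqrt (nsq b') := by
    have e1 := Real.sqrt_le_sqrt ha
    have e2 := Real.sqrt_le_sqrt hb
    have e3 := Real.mul_self_sqrt hmp.le
    calc m = Real.sqrt m * Real.sqrt m := e3.symm
      _ ≤ _ := by gcongr
  have h5 : m * X' ≤ k * s * (X * (1/2 + τ) - c0 * (Real.sqrt X)^3) := by
    calc m * X' ≤ Real.sqrt (nsq a) * Real.sqrt (nsq b') * X' := by gcongr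
      _ ≤ nsq (fun j => a j - b' j) := by rw [hE]; linarith [sq_nonneg (Real.sqrt (nsq a) - Real.sqrt (nsq b'))]
      _ ≤ _ := h4
  rw [hm, mul_assoc] at h5
  have h6 := le_of_mul_le_mul_left h5 hks
  nlinarith

lemma seq_lemma (n : ℕ) (e : ℕ → ℝ) (τ c : ℝ) (hc0 : 0 < c) (hc : c ≤ 1/6) (hτ : τ ≤ 1 / (n:ℝ)^4)
    (he0 : ∀ i, i ≤ n → 0 ≤ e i) (he2 : ∀ i, i ≤ n → e i ≤ 2)
    (hs : ∀ i, i < n → e (i+1)^2 ≤ e i ^2 - c * e i^3 + 16 * τ) :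
    ∀ i, i ≤ n → e i ≤ (4/c) / (i+1) := by
  set A := 4 / c with hA
  have hcA : c * A = 4 := by rw [hA]; field_simp
  have hA24 : 24 ≤ A := by
    rw [hA, le_div_iff₀ hc0]; linarith
  intro i
  induction i with
  | zero => 
    intro _
    have := he2 0 (by omega)
    simp; linarith
  | succ i ih =>
    intro hi
    have h1 := ih (by omega)
    have e0 := he0 i (by omega)
    have e2 := he2 (i+1) hi
    have e0' := he0 (i+1) hi
    push_cast
    set m : ℝ := (i:ℝ) + 1 with hm
    have hm1 : 1 ≤ m := by rw [hm]; have := Nat.cast_nonneg (α := ℝ) i; linarith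
    by_cases hbig : 2 ≤ A / (m+1)
    · linarith
    push Not at hbig
    rw [div_lt_iff₀ (by linarith)] at hbig
    have h4 : A / m ≤ 4 := by
      rw [div_le_iff₀ (by linarith)]; linarith
    have hτm : τ ≤ 1 / m^4 := by
      refine hτ.trans ?_
      apply one_div_le_one_div_of_le (by positivity)
      have : m ≤ n := by rw [hm]; exact_mod_cast hi
      gcongr
    have hst := hs i (by omega)
    set t := A / m with ht
    have htp : 0 < t := by positivity
    have hmono : e i ^2 - c * e i^3 ≤ t^2 - c * t^3 := by
      have h10 : 0 ≤ t - e i := by linarith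
      have h11 : c * (t^2 + t * e i + e i^2) ≤ t + e i := by
        have hb1 : c * (t + e i) ≤ 8 * c := by nlinarith
        nlinarith [mul_nonneg htp.le e0]
      nlinarith
    have htm : t * m = A := by rw [ht]; field_simp
    refine (pow_le_pow_iff_left₀ e0' (by positivity) two_ne_zero).1 ?_
    rw [div_pow]
    have hx : t^2 - c * t^3 + 16 * (1/m^4) ≤ A^2 / (m+1)^2 := by
      have ht2 : t^2 - c * t^3 + 16 * (1/m^4) = (A^2 * m^2 - c * A * A^2 * m + 16) / m^4 := by
        rw [ht]; field_simp
      rw [ht2, hcA, div_le_div_iff₀ (by positivity) (by positivity)]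
      have hAm : 576 ≤ A^2 := by nlinarith
      
      have : (m^2 - 4 * m + 1) * (m+1)^2 ≤ m^4 := by nlinarith [mul_nonneg (by linarith : 0 ≤ m) (sq_nonneg m)]
      have h16 : A^2 * m^2 - 4 * A^2 * m + 16 ≤ A^2 * (m^2 - 4 * m + 1) := by nlinarith
      calc _ ≤ A^2 * (m^2 - 4 * m + 1) * (m+1)^2 := by gcongr
        _ = A^2 * ((m^2 - 4 * m + 1) * (m+1)^2) := by ring
        _ ≤ A^2 * m^4 := by gcongr
    linarith

/-- all layers good for the pair -/
def GoodP {ℓ : ℕ} {D : ℕ → ℕ} (w : Wt ℓ D) (τ : ℝ) (x y : Fin (D 0) → ℝ) : Prop :=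
  ∀ j : Fin ℓ, GoodL (1 / (D j.1 : ℝ)) τ (w j) (hid w j.1 x) (hid w j.1 y)

lemma al_pos {ℓ : ℕ} {D : ℕ → ℕ} (hD : ∀ i, i ≤ ℓ → 0 < D i) {i : ℕ} (hi : i < ℓ) : (0:ℝ) < D (i+1) * (1 / (D i : ℝ)) := by
  have h1 : (0:ℝ) < D (i+1) := by exact_mod_cast hD (i+1) hi
  have h2 : (0:ℝ) < D i := by exact_mod_cast hD i hi.le
  positivity

lemma GoodP.pos_left {ℓ : ℕ} {D : ℕ → ℕ} (hD : ∀ i, i ≤ ℓ → 0 < D i) {w : Wt ℓ D} {τ : ℝ} (hτ : τ ≤ 1/8)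
    {x y : Fin (D 0) → ℝ} (hx : nsq x = 1) (hg : GoodP w τ x y) : ∀ i, i ≤ ℓ → 0 < nsq (hid w i x) := by
  intro i
  induction i with
  | zero => intro _; rw [hid_zero, hx]; norm_num
  | succ i ih =>
    intro hi
    have h := (hg ⟨i, hi⟩).1.1.2
    rw [← hid_succ w i hi] at h
    refine lt_of_lt_of_le ?_ h
    exact mul_pos (mul_pos (al_pos hD hi) (ih (by omega))) (by linarith)

lemma GoodP.pos_right {ℓ : ℕ} {D : ℕ → ℕ} (hD : ∀ i, i ≤ ℓ → 0 < D i) {w : Wt ℓ D} {τ : ℝ} (hτ : τ ≤ 1/8)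
    {x y : Fin (D 0) → ℝ} (hy : nsq y = 1) (hg : GoodP w τ x y) : ∀ i, i ≤ ℓ → 0 < nsq (hid w i y) := by
  intro i
  induction i with
  | zero => intro _; rw [hid_zero, hy]; norm_num
  | succ i ih =>
    intro hi
    have h := (hg ⟨i, hi⟩).1.2.2
    rw [← hid_succ w i hi] at h
    refine lt_of_lt_of_le ?_ h
    exact mul_pos (mul_pos (al_pos hD hi) (ih (by omega))) (by linarith)

lemma GoodP.dist {ℓ : ℕ} {D : ℕ → ℕ} (hD : ∀ i, i ≤ ℓ → 0 < D i) {w : Wt ℓ D} {τ : ℝ} (hτ0 : 0 ≤ τ) (hτ : τ ≤ 1/8)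
    (hτ4 : τ ≤ 1 / (ℓ:ℝ)^4)
    {x y : Fin (D 0) → ℝ} (hx : nsq x = 1) (hy : nsq y = 1) (hg : GoodP w τ x y) :
    Real.sqrt (nsq (fun j => nrmz (hid w ℓ x) j - nrmz (hid w ℓ y) j)) ≤ (2 / c0) / (ℓ + 1) := by
  have h := seq_lemma ℓ (fun i => Real.sqrt (nsq (fun j => nrmz (hid w i x) j - nrmz (hid w i y) j))) τ (2 * c0)
    (by have := c0_pos; linarith) (by have : c0 ≤ 1/12 := min_le_right _ _; linarith) hτ4
    (fun i _ => Real.sqrt_nonneg _) (fun i hi => by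
      have := dist_le_four (hg.pos_left hD hτ hx i hi) (hg.pos_right hD hτ hy i hi)
      rw [Real.sqrt_le_left (by norm_num)]; linarith) (fun i hi => by
      rw [Real.sq_sqrt (nsq_nonneg _), Real.sq_sqrt (nsq_nonneg _), hid_succ w i hi, hid_succ w i hi]
      exact step_dist _ _ _ (al_pos hD hi) hτ0 hτ (hg.pos_left hD hτ hx i hi.le) (hg.pos_right hD hτ hy i hi.le) (hg ⟨i, hi⟩)) ℓ le_rfl
  refine h.trans (le_of_eq ?_)
  have := c0_pos.ne'
  field_simp
  norm_num

lemma ratio_step {a u v p q τ : ℝ} (ha : 0 < a) (hτ0 : 0 ≤ τ) (hτ : τ ≤ 1/8) {R : ℝ} (hR : 0 ≤ R) (hv : 0 ≤ v)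
    (h1 : p ≤ a * u * (1/2 + τ)) (h2 : a * v * (1/2 - τ) ≤ q) (h3 : u ≤ R * v) : p ≤ (R * (1 + 8 * τ)) * q := by
  calc p ≤ a * u * (1/2 + τ) := h1
    _ ≤ a * (R * v) * (1/2 + τ) := by gcongr
    _ ≤ (R * (1 + 8 * τ)) * (a * v * (1/2 - τ)) := by
      have : (1/2 + τ) ≤ (1 + 8 * τ) * (1/2 - τ) := by nlinarith
      have h0 : 0 ≤ a * (R * v) := by positivity
      nlinarith
    _ ≤ _ := by gcongr

lemma GoodP.ratio {ℓ : ℕ} {D : ℕ → ℕ} (hD : ∀ i, i ≤ ℓ → 0 < D i) {w : Wt ℓ D} {τ : ℝ} (hτ0 : 0 ≤ τ) (hτ : τ ≤ 1/8)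
    {x y : Fin (D 0) → ℝ} (hx : nsq x = 1) (hy : nsq y = 1) (hg : GoodP w τ x y) : ∀ i, i ≤ ℓ →
    nsq (hid w i x) ≤ (1 + 8 * τ)^i * nsq (hid w i y) ∧ nsq (hid w i y) ≤ (1 + 8 * τ)^i * nsq (hid w i x) := by
  intro i
  induction i with
  | zero => intro _; simp [hid_zero, hx, hy]
  | succ i ih =>
    intro hi
    obtain ⟨h1, h2⟩ := ih (by omega)
    obtain ⟨⟨⟨a1, a2⟩, b1, b2⟩, -⟩ := hg ⟨i, hi⟩
    rw [← hid_succ w i hi] at a1 a2 b1 b2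
    rw [pow_succ]
    exact ⟨ratio_step (al_pos hD hi) hτ0 hτ (by positivity) (nsq_nonneg _) a1 b2 h1,
      ratio_step (al_pos hD hi) hτ0 hτ (by positivity) (nsq_nonneg _) b1 a2 h2⟩

lemma pow_bound {ℓ : ℕ} (hl : 16 ≤ ℓ) {τ : ℝ} (hτ0 : 0 ≤ τ) (hτ4 : τ ≤ 1 / (ℓ:ℝ)^4) :
    (1 + 8 * τ)^ℓ ≤ 1 + 1 / (ℓ:ℝ)^2 := by
  have hl' : (16:ℝ) ≤ ℓ := by exact_mod_cast hl
  have h1 : (1 + 8 * τ)^ℓ ≤ Real.exp (ℓ * (8 * τ)) := by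
    rw [Real.exp_nat_mul]
    gcongr
    linarith [Real.add_one_le_exp (8 * τ)]
  have h2 : ℓ * (8 * τ) ≤ 1 / (2 * (ℓ:ℝ)^2) := by
    calc ℓ * (8 * τ) ≤ ℓ * (8 * (1 / (ℓ:ℝ)^4)) := by gcongr
      _ ≤ _ := by
        rw [show (ℓ:ℝ) * (8 * (1 / (ℓ:ℝ)^4)) = 8 / ℓ^3 by field_simp]
        rw [div_le_div_iff₀ (by positivity) (by positivity)]
        nlinarith [sq_nonneg (ℓ:ℝ)]
  have h3 : 1 / (2 * (ℓ:ℝ)^2) ≤ 1/2 := by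
    apply one_div_le_one_div_of_le (by norm_num); nlinarith
  have h0 : 0 ≤ ℓ * (8 * τ) := by positivity
  have h4 : Real.exp (ℓ * (8 * τ)) ≤ 1 + 2 * (ℓ * (8 * τ)) := by
    have := Real.abs_exp_sub_one_le (x := ℓ * (8 * τ)) (by rw [abs_of_nonneg h0]; linarith)
    rw [abs_of_nonneg h0] at this
    linarith [le_abs_self (Real.exp (ℓ * (8 * τ)) - 1)]
  have h5 : 2 * (1 / (2 * (ℓ:ℝ)^2)) = 1 / (ℓ:ℝ)^2 := by field_simp
  linarith

/-- contraction constant -/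
def A1 : ℝ := 12 / c0^2

lemma GoodP.close {ℓ : ℕ} (hl : 16 ≤ ℓ) {D : ℕ → ℕ} (hD : ∀ i, i ≤ ℓ → 0 < D i) {w : Wt ℓ D} {τ : ℝ} (hτ0 : 0 ≤ τ)
    (hτ4 : τ ≤ 1 / (ℓ:ℝ)^4)
    {x y : Fin (D 0) → ℝ} (hx : nsq x = 1) (hy : nsq y = 1) (hg : GoodP w τ x y) :
    nsq (fun j => hid w ℓ x j - hid w ℓ y j) ≤ A1 / ℓ^2 * nsq (hid w ℓ y) ∧ nsq (hid w ℓ x) ≤ 2 * nsq (hid w ℓ y) := by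
  have hl' : (16:ℝ) ≤ ℓ := by exact_mod_cast hl
  have hτ : τ ≤ 1/8 := by
    refine hτ4.trans (one_div_le_one_div_of_le (by norm_num) ?_)
    have : (16:ℝ)^4 ≤ (ℓ:ℝ)^4 := by gcongr
    linarith
  have hu := hg.pos_left hD hτ hx ℓ le_rfl
  have hv := hg.pos_right hD hτ hy ℓ le_rfl
  have hd := hg.dist hD hτ0 hτ hτ4 hx hy
  have hp := pow_bound hl hτ0 hτ4
  obtain ⟨r1, r2⟩ := hg.ratio hD hτ0 hτ hx hy ℓ le_rfl
  rw [nsq_sub_eq hu hv]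
  set u := hid w ℓ x
  set v := hid w ℓ y
  set X := nsq (fun j => nrmz u j - nrmz v j)
  have hXn : 0 ≤ X := nsq_nonneg _
  have hc := c0_pos
  have hc2 : c0 ≤ 1/12 := min_le_right _ _
  have hX : X ≤ 4 / c0^2 / ℓ^2 := by
    have : X = (Real.sqrt X)^2 := (Real.sq_sqrt hXn).symm
    rw [this]
    calc (Real.sqrt X)^2 ≤ ((2 / c0) / (ℓ + 1))^2 := by gcongr
      _ ≤ ((2 / c0) / ℓ)^2 := by gcongr; linarith
      _ = _ := by field_simp; norm_num
  have hq : 1 / (ℓ:ℝ)^2 ≤ 1 := by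
    rw [div_le_one (by positivity)]; nlinarith
  have r1' : nsq u ≤ (1 + 1 / (ℓ:ℝ)^2) * nsq v := r1.trans (by gcongr)
  have r2' : nsq v ≤ (1 + 1 / (ℓ:ℝ)^2) * nsq u := r2.trans (by gcongr)
  have hu2 : nsq u ≤ 2 * nsq v := r1'.trans (by gcongr; linarith)
  refine ⟨?_, hu2⟩
  set a := Real.sqrt (nsq u) with ha
  set b := Real.sqrt (nsq v) with hb
  have ha0 : 0 < a := Real.sqrt_pos.2 hu
  have hb0 : 0 < b := Real.sqrt_pos.2 hv
  have ea : a^2 = nsq u := Real.sq_sqrt hu.le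
  have eb : b^2 = nsq v := Real.sq_sqrt hv.le
  rw [← ea, ← eb] at r1' r2' hu2
  rw [← eb]
  have t1 : (a - b)^2 ≤ 2 * (1 / (ℓ:ℝ)^2) * b^2 := by
    have hx0 : 0 ≤ 1 / (ℓ:ℝ)^2 := by positivity
    rcases le_total a b with h | h
    · have : (a-b)^2 ≤ b^2 - a^2 := by nlinarith
      have h2 : b^2 - a^2 ≤ 1 / (ℓ:ℝ)^2 * a^2 := by linarith
      have h3 : 1 / (ℓ:ℝ)^2 * a^2 ≤ 1 / (ℓ:ℝ)^2 * (2 * b^2) := by gcongr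
      linarith
    · have : (a-b)^2 ≤ a^2 - b^2 := by nlinarith
      have h2 : a^2 - b^2 ≤ 1 / (ℓ:ℝ)^2 * b^2 := by linarith
      have h3 : 0 ≤ 1 / (ℓ:ℝ)^2 * b^2 := by positivity
      linarith
  have t2 : a * b ≤ 2 * b^2 := by nlinarith
  have t3 : a * b * X ≤ 2 * b^2 * (4 / c0^2 / ℓ^2) := by gcongr
  have t4 : 2 ≤ 4 / c0^2 := by
    rw [le_div_iff₀ (by positivity)]; nlinarith
  calc (a-b)^2 + a * b * X ≤ 2 * (1 / (ℓ:ℝ)^2) * b^2 + 2 * b^2 * (4 / c0^2 / ℓ^2) := by linarith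
    _ ≤ (4 / c0^2) * (1 / (ℓ:ℝ)^2) * b^2 + 2 * b^2 * (4 / c0^2 / ℓ^2) := by gcongr
    _ = A1 / ℓ^2 * b^2 := by unfold A1; field_simp; norm_num

lemma nsq_lay_sub {k b : ℕ} (W : Fin k → Fin b → ℝ) (u v : Fin b → ℝ) :
    nsq (fun j => lay W u j - lay W v j) ≤ nsq (fun j => ∑ i, W j i * (u i - v i)) := by
  unfold nsq
  refine Finset.sum_le_sum fun j _ => ?_
  simp only [dot_sub]
  exact relu_sub_sq _ _

lemma GoodP.lip {ℓ : ℕ} {D : ℕ → ℕ} (hD : ∀ i, i ≤ ℓ → 0 < D i) {w : Wt ℓ D} {τ : ℝ} (hτ : τ ≤ 1/8)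
    {x y : Fin (D 0) → ℝ} (hy : nsq y = 1) (hg : GoodP w τ x y) : ∀ i, i ≤ ℓ →
    nsq (fun j => hid w i x j - hid w i y j) ≤ 8^i * nsq (fun j => x j - y j) * nsq (hid w i y) := by
  intro i
  induction i with
  | zero => intro _; simp [hid_zero, hy]
  | succ i ih =>
    intro hi
    have h1 := ih (by omega)
    obtain ⟨⟨-, -, b2⟩, h3, -⟩ := hg ⟨i, hi⟩
    rw [← hid_succ w i hi] at b2
    have h4 := nsq_lay_sub (w ⟨i, hi⟩) (hid w i x) (hid w i y)
    rw [← hid_succ w i hi, ← hid_succ w i hi] at h4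
    have ha := al_pos hD hi
    simp only at b2 h3
    set a := (D (i+1) : ℝ) * (1 / (D i : ℝ))
    have hn := nsq_nonneg (hid w i y)
    have hxy := nsq_nonneg (fun j => x j - y j)
    have b3 : a * nsq (hid w i y) ≤ 4 * nsq (hid w (i+1) y) := by
      have : a * nsq (hid w i y) * (3/8) ≤ a * nsq (hid w i y) * (1/2 - τ) := by
        gcongr; linarith
      have h0 : 0 ≤ a * nsq (hid w i y) := by positivity
      linarith
    calc _ ≤ _ := h4.trans h3
      _ ≤ a * (8^i * nsq (fun j => x j - y j) * nsq (hid w i y)) * (1 + 1) := by gcongr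
      _ = 8^i * 2 * nsq (fun j => x j - y j) * (a * nsq (hid w i y)) := by ring
      _ ≤ 8^i * 2 * nsq (fun j => x j - y j) * (4 * nsq (hid w (i+1) y)) := by gcongr
      _ = _ := by ring

/-- squared Frobenius norm -/
def fro {a b : ℕ} (W : Fin a → Fin b → ℝ) : ℝ := ∑ j, nsq (W j)

lemma fro_bound {a b : ℕ} (W : Fin a → Fin b → ℝ) (u : Fin b → ℝ) : nsq (fun j => ∑ i, W j i * u i) ≤ fro W * nsq u := by
  unfold fro
  rw [Finset.sum_mul]
  conv_lhs => unfold nsq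
  refine Finset.sum_le_sum fun j _ => ?_
  exact Finset.sum_mul_sq_le_sq_mul_sq _ _ _

lemma GoodP.fine {ℓ : ℕ} {D : ℕ → ℕ} (hD : ∀ i, i ≤ ℓ → 0 < D i) (hD1 : ∀ i, i < ℓ → D i ≤ D (i+1)) {w : Wt ℓ D} {τ : ℝ} (hτ : τ ≤ 1/8)
    {z y : Fin (D 0) → ℝ} (hy : nsq y = 1) (hg : GoodP w τ z y) {B : ℝ} (hB : 0 ≤ B) (hf : ∀ j, fro (w j) ≤ B)
    (x x' : Fin (D 0) → ℝ) : ∀ i, i ≤ ℓ →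
    nsq (fun j => hid w i x j - hid w i x' j) ≤ (4*B)^i * nsq (fun j => x j - x' j) * nsq (hid w i y) := by
  intro i
  induction i with
  | zero => intro _; simp [hid_zero, hy]
  | succ i ih =>
    intro hi
    have h1 := ih (by omega)
    obtain ⟨⟨-, -, b2⟩, -⟩ := hg ⟨i, hi⟩
    rw [← hid_succ w i hi] at b2
    have h4 := nsq_lay_sub (w ⟨i, hi⟩) (hid w i x) (hid w i x')
    rw [← hid_succ w i hi, ← hid_succ w i hi] at h4
    have h5 := fro_bound (w ⟨i, hi⟩) (fun m => hid w i x m - hid w i x' m)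
    have hDi : (0:ℝ) < D i := by exact_mod_cast hD i (by omega)
    have ha : (1:ℝ) ≤ (D (i+1) : ℝ) * (1 / (D i : ℝ)) := by
      have := hD1 i hi
      rw [mul_one_div, le_div_iff₀ hDi, one_mul]
      exact_mod_cast this
    simp only at b2
    set a := (D (i+1) : ℝ) * (1 / (D i : ℝ))
    have hn := nsq_nonneg (hid w i y)
    have hxy := nsq_nonneg (fun j => x j - x' j)
    have b3 : nsq (hid w i y) ≤ 4 * nsq (hid w (i+1) y) := by
      have : 1 * nsq (hid w i y) * (3/8) ≤ a * nsq (hid w i y) * (1/2 - τ) := by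
        gcongr; linarith
      linarith
    calc _ ≤ fro (w ⟨i, hi⟩) * nsq (fun m => hid w i x m - hid w i x' m) := h4.trans h5
      _ ≤ B * nsq (fun m => hid w i x m - hid w i x' m) := by
        have := nsq_nonneg (fun m => hid w i x m - hid w i x' m)
        gcongr; exact hf _
      _ ≤ B * ((4*B)^i * nsq (fun j => x j - x' j) * nsq (hid w i y)) := by gcongr
      _ ≤ B * ((4*B)^i * nsq (fun j => x j - x' j) * (4 * nsq (hid w (i+1) y))) := by gcongr
      _ = _ := by ring

lemma abs_le_one_of_nsq {n : ℕ} {x : Fin n → ℝ} (h : nsq x = 1) (i : Fin n) : |x i| ≤ 1 := by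
  have : x i ^2 ≤ nsq x := Finset.single_le_sum (f := fun i => x i ^2) (fun i _ => sq_nonneg _) (Finset.mem_univ i)
  rw [h] at this
  exact (sq_le_one_iff_abs_le_one _).1 this

lemma net_exists (n M : ℕ) (hM : 0 < M) : ∃ N : Finset (Fin n → ℝ), N.card ≤ (2*M+1)^n ∧ (∀ p ∈ N, nsq p = 1) ∧
    ∀ x, nsq x = 1 → ∃ p ∈ N, nsq (fun j => x j - p j) ≤ n / (M:ℝ)^2 := by
  classical
  let cell : (Fin n → ℝ) → (Fin n → Fin (2*M+1)) := fun x i => Fin.ofNat (2*M+1) ⌊x i * M + M⌋₊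
  let P : (Fin n → Fin (2*M+1)) → Prop := fun c => ∃ x : Fin n → ℝ, nsq x = 1 ∧ cell x = c
  let rep : (Fin n → Fin (2*M+1)) → (Fin n → ℝ) := fun c => if h : P c then h.choose else 0
  have hrep : ∀ c, P c → nsq (rep c) = 1 ∧ cell (rep c) = c := by
    intro c hc
    simp only [rep, hc, dif_pos]
    exact hc.choose_spec
  refine ⟨(Finset.univ.filter P).image rep, ?_, ?_, ?_⟩
  · refine Finset.card_image_le.trans ((Finset.card_filter_le _ _).trans ?_)
    simp
  · intro p hp
    simp only [Finset.mem_image, Finset.mem_filter, Finset.mem_univ, true_and] at hp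
    obtain ⟨c, hc, rfl⟩ := hp
    exact (hrep c hc).1
  · intro x hx
    have hP : P (cell x) := ⟨x, hx, rfl⟩
    obtain ⟨h1, h2⟩ := hrep _ hP
    refine ⟨rep (cell x), ?_, ?_⟩
    · simp only [Finset.mem_image, Finset.mem_filter, Finset.mem_univ, true_and]
      exact ⟨_, hP, rfl⟩
    set y := rep (cell x)
    have hMr : (0:ℝ) < M := by exact_mod_cast hM
    have fl : ∀ z : Fin n → ℝ, nsq z = 1 → ∀ i, (0 ≤ z i * M + M) ∧ ⌊z i * M + M⌋₊ < 2*M+1 := by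
      intro z hz i
      have := abs_le.1 (abs_le_one_of_nsq hz i)
      refine ⟨by nlinarith, ?_⟩
      rw [Nat.lt_succ_iff]
      apply Nat.floor_le_of_le
      push_cast
      nlinarith
    have hi : ∀ i, (x i - y i)^2 ≤ 1 / (M:ℝ)^2 := by
      intro i
      have h3 := congrArg Fin.val (congrFun h2 i)
      simp only [cell, Fin.val_ofNat] at h3
      rw [Nat.mod_eq_of_lt (fl y h1 i).2, Nat.mod_eq_of_lt (fl x hx i).2] at h3
      have a1 := Nat.floor_le (fl x hx i).1
      have a2 := Nat.lt_floor_add_one (x i * M + M)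
      have b1 := Nat.floor_le (fl y h1 i).1
      have b2 := Nat.lt_floor_add_one (y i * M + M)
      rw [h3] at b1 b2
      rw [le_div_iff₀ (by positivity), ← mul_pow]
      rw [sq_le_one_iff_abs_le_one, abs_le]
      constructor <;> nlinarith
    calc nsq (fun j => x j - y j) ≤ ∑ j : Fin n, 1 / (M:ℝ)^2 := Finset.sum_le_sum fun i _ => hi i
      _ = n / (M:ℝ)^2 := by simp [div_eq_mul_inv]

/-- Gaussian tail -/
lemma gauss_tail (t : ℝ) (ht : 0 ≤ t) : gaussianReal 0 1 {x | t < |x|} ≤ ENNReal.ofReal (2 * Real.exp (-t^2/2)) := by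
  have h1 : ∀ σ : ℝ, (σ = 1 ∨ σ = -1) → (gaussianReal 0 1).real {x | t ≤ σ * x} ≤ Real.exp (-t^2/2) := by
    intro σ hσ
    have hmg : mgf (fun x => σ * x) (gaussianReal 0 1) t = Real.exp (t^2/2) := by
      have : (gaussianReal 0 1).map (fun x => σ * x) = gaussianReal 0 1 := by
        rw [gaussianReal_map_const_mul]
        rcases hσ with rfl | rfl <;> · congr 1; · simp
                                       · ext; simp
      rw [mgf_gaussianReal this]; simp
    have hInt0 : Integrable (fun x => Real.exp (t * (σ * x))) (gaussianReal 0 1) := by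
      have := integrable_exp_mul_gaussianReal (μ := 0) (v := 1) (t * σ)
      simpa [mul_assoc] using this
    have := measure_ge_le_exp_mul_mgf (μ := gaussianReal 0 1) (X := fun x => σ * x) t ht hInt0
    rw [hmg, ← Real.exp_add] at this
    refine this.trans (le_of_eq ?_)
    congr 1; ring
  have hsub : {x : ℝ | t < |x|} ⊆ {x | t ≤ 1 * x} ∪ {x | t ≤ (-1) * x} := by
    intro x hx
    simp only [Set.mem_ofPred_eq, Set.mem_union] at hx ⊢
    rcases lt_abs.1 hx with h | h
    · left; linarith
    · right; linarith
  calc gaussianReal 0 1 {x | t < |x|} ≤ gaussianReal 0 1 {x | t ≤ 1 * x} + gaussianReal 0 1 {x | t ≤ (-1) * x} :=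
        (measure_mono hsub).trans (measure_union_le _ _)
    _ ≤ ENNReal.ofReal (Real.exp (-t^2/2)) + ENNReal.ofReal (Real.exp (-t^2/2)) := by
      gcongr
      · rw [← ofReal_measureReal]; exact ENNReal.ofReal_le_ofReal (h1 1 (by simp))
      · rw [← ofReal_measureReal]; exact ENNReal.ofReal_le_ofReal (h1 (-1) (by simp))
    _ = _ := by rw [← ENNReal.ofReal_add (by positivity) (by positivity)]; congr 1; ring

/-- tail for a linear form; `s` variance of entries -/
lemma row_tail {b : ℕ} (s : NNReal) (u : Fin b → ℝ) (t : ℝ) (ht : 0 ≤ t) :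
    rowM b s {r | t * Real.sqrt (s * nsq u) < |∑ j, r j * u j|} ≤ ENNReal.ofReal (2 * Real.exp (-t^2/2)) := by
  have hm : Measurable (fun r : Fin b → ℝ => ∑ j, r j * u j) := by fun_prop
  have hS : MeasurableSet {z : ℝ | t * Real.sqrt (s * nsq u) < |z|} := measurableSet_lt (by fun_prop) (by fun_prop)
  have e : rowM b s {r | t * Real.sqrt (s * nsq u) < |∑ j, r j * u j|} =
      (rowM b s).map (fun r => ∑ j, r j * u j) {z : ℝ | t * Real.sqrt (s * nsq u) < |z|} := by
    rw [Measure.map_apply hm hS]; rfl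
  rw [e, row_law', gauss_std, Measure.map_apply (by fun_prop) hS]
  refine le_trans (measure_mono ?_) (gauss_tail t ht)
  intro z hz
  simp only [Set.mem_preimage, Set.mem_ofPred_eq, rowq_coe, abs_mul, abs_of_nonneg (Real.sqrt_nonneg _)] at hz ⊢
  have h0 := Real.sqrt_nonneg (s * nsq u)
  by_contra hc
  push Not at hc
  nlinarith

lemma row_small {b : ℕ} (s : NNReal) (u : Fin b → ℝ) (t : ℝ) (ht : 0 ≤ t) :
    rowM b s {r | |∑ j, r j * u j| < t * Real.sqrt (s * nsq u)} ≤ ENNReal.ofReal t := by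
  have hm : Measurable (fun r : Fin b → ℝ => ∑ j, r j * u j) := by fun_prop
  have hS : MeasurableSet {z : ℝ | |z| < t * Real.sqrt (s * nsq u)} := measurableSet_lt (by fun_prop) (by fun_prop)
  have e : rowM b s {r | |∑ j, r j * u j| < t * Real.sqrt (s * nsq u)} =
      (rowM b s).map (fun r => ∑ j, r j * u j) {z : ℝ | |z| < t * Real.sqrt (s * nsq u)} := by
    rw [Measure.map_apply hm hS]; rfl
  rw [e, row_law', gauss_std, Measure.map_apply (by fun_prop) hS]
  refine le_trans (measure_mono ?_) (small_ball_upper t ht)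
  intro z hz
  simp only [Set.mem_preimage, Set.mem_ofPred_eq, rowq_coe, abs_mul, abs_of_nonneg (Real.sqrt_nonneg _)] at hz ⊢
  have h0 := Real.sqrt_nonneg (s * nsq u)
  by_contra hc
  push Not at hc
  nlinarith

/-- second moment of the row -/
lemma row_nsq {b : ℕ} (s : NNReal) : Integrable (fun r : Fin b → ℝ => nsq r) (rowM b s) ∧ ∫ r, nsq r ∂(rowM b s) = b * s := by
  have h1 : ∀ j : Fin b, Integrable (fun r : Fin b → ℝ => r j ^2) (rowM b s) ∧ ∫ r, r j ^2 ∂(rowM b s) = s := by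
    intro j
    have a := row_sq_int s (Pi.single j (1:ℝ))
    have c := row_sq s (Pi.single j (1:ℝ))
    have e : nsq (Pi.single j (1:ℝ)) = 1 := by
      unfold nsq
      rw [Finset.sum_eq_single j] <;> simp +contextual
    simp only [Pi.single_apply, mul_ite, mul_one, mul_zero, Finset.sum_ite_eq', Finset.mem_univ, if_true] at a
    simp only [e] at c
    simp only [Pi.single_apply, mul_ite, mul_one, mul_zero, Finset.sum_ite_eq', Finset.mem_univ, if_true] at c
    exact ⟨a, c⟩
  unfold nsq
  refine ⟨integrable_finsetSum _ fun j _ => (h1 j).1, ?_⟩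
  rw [integral_finsetSum _ fun j _ => (h1 j).1]
  simp [fun j => (h1 j).2]

lemma row_nsq_markov {b : ℕ} (s : NNReal) (T : ℝ) (hT : 0 < T) : rowM b s {r | T < nsq r} ≤ ENNReal.ofReal (b * s / T) := by
  obtain ⟨h1, h2⟩ := row_nsq (b := b) s
  have := mul_meas_ge_le_integral_of_nonneg (μ := rowM b s) (f := fun r => nsq r) (Filter.Eventually.of_forall fun r => nsq_nonneg r) h1 T
  rw [h2] at this
  have h3 : (rowM b s).real {r | T ≤ nsq r} ≤ b * s / T := by
    rw [le_div_iff₀ hT]; linarith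
  calc rowM b s {r | T < nsq r} ≤ rowM b s {r | T ≤ nsq r} := measure_mono fun r hr => by
        simp only [Set.mem_ofPred_eq] at hr ⊢; exact hr.le
    _ ≤ _ := by rw [← ofReal_measureReal]; exact ENNReal.ofReal_le_ofReal h3

lemma fro_markov {a b : ℕ} (s : NNReal) (T : ℝ) (hT : 0 < T) :
    gaussMat a b s {W | T < fro W} ≤ ENNReal.ofReal (a * (b * s) / T) := by
  obtain ⟨h1, h2⟩ := row_nsq (b := b) s
  have hmp : ∀ j : Fin a, MeasurePreserving (Function.eval j) (gaussMat a b s) (rowM b s) := by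
    intro j; exact measurePreserving_eval (fun _ : Fin a => rowM b s) j
  have hi : ∀ j : Fin a, Integrable (fun W : Fin a → Fin b → ℝ => nsq (W j)) (gaussMat a b s) ∧
      ∫ W, nsq (W j) ∂(gaussMat a b s) = b * s := by
    intro j
    refine ⟨(hmp j).integrable_comp_of_integrable h1, ?_⟩
    rw [← h2, ← (hmp j).map_eq, integral_map (measurable_pi_apply j).aemeasurable]
    rw [show Measure.map (fun f : Fin a → Fin b → ℝ => f j) (gaussMat a b s) = rowM b s from (hmp j).map_eq]
    exact h1.1
  have h3 : Integrable (fun W : Fin a → Fin b → ℝ => fro W) (gaussMat a b s) := by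
    unfold fro
    exact integrable_finsetSum _ fun j _ => (hi j).1
  have h4 : ∫ W, fro W ∂(gaussMat a b s) = a * (b * s) := by
    unfold fro
    rw [integral_finsetSum _ fun j _ => (hi j).1]
    simp [fun j => (hi j).2]
  have := mul_meas_ge_le_integral_of_nonneg (μ := gaussMat a b s) (f := fun W => fro W)
    (Filter.Eventually.of_forall fun W => Finset.sum_nonneg fun j _ => nsq_nonneg _) h3 T
  rw [h4] at this
  have h5 : (gaussMat a b s).real {W | T ≤ fro W} ≤ a * (b * s) / T := by
    rw [le_div_iff₀ hT]; linarith
  calc gaussMat a b s {r | T < fro r} ≤ gaussMat a b s {r | T ≤ fro r} := measure_mono fun r hr => by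
        simp only [Set.mem_ofPred_eq] at hr ⊢; exact hr.le
    _ ≤ _ := by rw [← ofReal_measureReal]; exact ENNReal.ofReal_le_ofReal h5

lemma meas_fro {a b : ℕ} : Measurable (fro : (Fin a → Fin b → ℝ) → ℝ) := by
  unfold fro nsq; fun_prop

lemma hidden_fro {ℓ : ℕ} {D : ℕ → ℕ} (j : Fin ℓ) (T : ℝ) (hT : 0 < T) (hD : D j.1 ≠ 0) :
    hiddenMeasure ℓ D {w | T < fro (w j)} ≤ ENNReal.ofReal (D (j.1+1) / T) := by
  have hm : MeasurePreserving (Function.eval j) (hiddenMeasure ℓ D) (gaussMat (D (j.1+1)) (D j.1) (1 / (D j.1 : NNReal))) :=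
    measurePreserving_eval (fun i : Fin ℓ => gaussMat (D (i.1+1)) (D i.1) (1 / (D i.1 : NNReal))) j
  have hS : MeasurableSet {W : Fin (D (j.1+1)) → Fin (D j.1) → ℝ | T < fro W} := measurableSet_lt measurable_const meas_fro
  have := fro_markov (a := D (j.1+1)) (b := D j.1) (1 / (D j.1 : NNReal)) T hT
  rw [← hm.map_eq, Measure.map_apply hm.measurable hS] at this
  refine this.trans (ENNReal.ofReal_le_ofReal (le_of_eq ?_))
  have : (D j.1 : ℝ) ≠ 0 := by exact_mod_cast hD
  push_cast
  field_simp

lemma biU_le {Ω α : Type*} [MeasurableSpace Ω] (μ : Measure Ω) (N : Finset α) (S : α → Set Ω) (c : ENNReal)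
    (h : ∀ p ∈ N, μ (S p) ≤ c) : μ (⋃ p ∈ N, S p) ≤ N.card * c := by
  refine (measure_biUnion_finset_le N S).trans ?_
  refine (Finset.sum_le_card_nsmul N _ c h).trans ?_
  rw [nsmul_eq_mul]

lemma iU_le {Ω : Type*} [MeasurableSpace Ω] (μ : Measure Ω) (n : ℕ) (S : Fin n → Set Ω) (c : ENNReal)
    (h : ∀ p, μ (S p) ≤ c) : μ (⋃ p, S p) ≤ n * c := by
  have := biU_le μ Finset.univ S c (fun p _ => h p)
  simpa using this

lemma prod_slice {Ω Ω' : Type*} [MeasurableSpace Ω] [MeasurableSpace Ω'] (μ : Measure Ω) (ν : Measure Ω')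
    [IsProbabilityMeasure μ] [IsProbabilityMeasure ν] (S : Set (Ω × Ω')) (hS : MeasurableSet S) (c : ENNReal)
    (h : ∀ w, ν {v | (w, v) ∈ S} ≤ c) : μ.prod ν S ≤ c := by
  rw [Measure.prod_apply hS]
  calc _ ≤ ∫⁻ _, c ∂μ := lintegral_mono fun w => h w
    _ = c := by simp

lemma prod_fst {Ω Ω' : Type*} [MeasurableSpace Ω] [MeasurableSpace Ω'] (μ : Measure Ω) (ν : Measure Ω')
    [IsProbabilityMeasure μ] [IsProbabilityMeasure ν] (H : Set Ω) :
    μ.prod ν {ω | ω.1 ∈ H} ≤ μ H := by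
  have : {ω : Ω × Ω' | ω.1 ∈ H} = H ×ˢ Set.univ := by ext; simp
  rw [this, Measure.prod_prod]; simp

abbrev Om (ℓ : ℕ) (D : ℕ → ℕ) := Wt ℓ D × (Fin (D ℓ) → ℝ)

section
variable {ℓ : ℕ} {D : ℕ → ℕ}

lemma wm_eq : weightMeasure ℓ D = (hiddenMeasure ℓ D).prod (rowM (D ℓ) (1 / (D ℓ : NNReal))) := rfl

def Stail (t : ℝ) (p q : Fin (D 0) → ℝ) : Set (Om ℓ D) :=
  {ω | t * Real.sqrt ((1 / (D ℓ : NNReal) : NNReal) * nsq (fun j => hid ω.1 ℓ p j - hid ω.1 ℓ q j)) <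
    |∑ j, ω.2 j * (hid ω.1 ℓ p j - hid ω.1 ℓ q j)|}

def Ssmall (t : ℝ) (p : Fin (D 0) → ℝ) : Set (Om ℓ D) :=
  {ω | |∑ j, ω.2 j * hid ω.1 ℓ p j| < t * Real.sqrt ((1 / (D ℓ : NNReal) : NNReal) * nsq (hid ω.1 ℓ p))}

lemma meas_hid' (p : Fin (D 0) → ℝ) (j : Fin (D ℓ)) : Measurable fun ω : Om ℓ D => hid ω.1 ℓ p j :=
  (measurable_pi_apply j).comp ((meas_hid p ℓ le_rfl).comp measurable_fst)

lemma Stail_le (t : ℝ) (ht : 0 ≤ t) (p q : Fin (D 0) → ℝ) :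
    weightMeasure ℓ D (Stail t p q) ≤ ENNReal.ofReal (2 * Real.exp (-t^2/2)) := by
  rw [wm_eq]
  apply prod_slice
  · have h1 := meas_hid' (ℓ := ℓ) p
    have h2 := meas_hid' (ℓ := ℓ) q
    unfold Stail nsq
    exact measurableSet_lt (by fun_prop) (by fun_prop)
  · intro w
    exact row_tail _ (fun j => hid w ℓ p j - hid w ℓ q j) t ht

lemma Ssmall_le (t : ℝ) (ht : 0 ≤ t) (p : Fin (D 0) → ℝ) :
    weightMeasure ℓ D (Ssmall t p) ≤ ENNReal.ofReal t := by
  rw [wm_eq]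
  apply prod_slice
  · have h1 := meas_hid' (ℓ := ℓ) p
    unfold Ssmall nsq
    exact measurableSet_lt (by fun_prop) (by fun_prop)
  · intro w
    exact row_small _ (hid w ℓ p) t ht

lemma Sv_le (hD : D ℓ ≠ 0) :
    weightMeasure ℓ D {ω | 100 < nsq ω.2} ≤ ENNReal.ofReal (1/100) := by
  rw [wm_eq]
  apply prod_slice
  · unfold nsq
    exact measurableSet_lt (by fun_prop) (by fun_prop)
  · intro w
    refine (row_nsq_markov _ 100 (by norm_num)).trans (ENNReal.ofReal_le_ofReal (le_of_eq ?_))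
    have : (D ℓ : ℝ) ≠ 0 := by exact_mod_cast hD
    push_cast
    field_simp

lemma Sfro_le (T : ℝ) (hT : 0 < T) (k : ℕ) (hD0 : ∀ i, i ≤ ℓ → 0 < D i) (hD : ∀ i, 1 ≤ i → i ≤ ℓ → D i = k) :
    weightMeasure ℓ D (⋃ j : Fin ℓ, {ω | T < fro (ω.1 j)}) ≤ ℓ * ENNReal.ofReal (k / T) := by
  apply iU_le
  intro j
  rw [wm_eq]
  refine (prod_fst _ _ {w : Wt ℓ D | T < fro (w j)}).trans ?_
  have := hidden_fro j T hT (hD0 j.1 j.2.le).ne'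
  refine this.trans (le_of_eq ?_)
  have e := hD (j.1+1) (by omega) j.2
  congr 3

lemma Sgood_le (k : ℕ) (hk : 64 ≤ k) (τ : ℝ) (hτ : τ ≤ 1) (hD0 : ∀ i, i ≤ ℓ → 0 < D i) (hD : ∀ i, 1 ≤ i → i ≤ ℓ → D i = k)
    (p q : Fin (D 0) → ℝ) :
    weightMeasure ℓ D {ω | ¬ GoodP ω.1 τ p q} ≤ ℓ * (6 * pf k τ) := by
  have e : {ω : Om ℓ D | ¬ GoodP ω.1 τ p q} = ⋃ j : Fin ℓ, {ω | ¬ GoodL (1 / (D j.1 : ℝ)) τ (ω.1 j) (hid ω.1 j.1 p) (hid ω.1 j.1 q)} := by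
    ext ω
    simp [GoodP]
  rw [e]
  apply iU_le
  intro j
  rw [wm_eq]
  refine (prod_fst _ _ {w : Wt ℓ D | ¬ GoodL (1 / (D j.1 : ℝ)) τ (w j) (hid w j.1 p) (hid w j.1 q)}).trans ?_
  exact pair_bad hk τ hτ j (hD (j.1+1) (by omega) j.2) (hD0 j.1 j.2.le).ne' p q

lemma net_sub (ω : Om ℓ D) (x y : Fin (D 0) → ℝ) : netOutput ℓ D ω.1 ω.2 x - netOutput ℓ D ω.1 ω.2 y =
    ∑ j, ω.2 j * (hid ω.1 ℓ x j - hid ω.1 ℓ y j) := by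
  rw [dot_sub]; rfl

/-- deterministic conclusion -/
lemma det_concl (hl : 16 ≤ ℓ) (k : ℕ) (hk : 0 < k) (hDℓ : D ℓ = k) (hD : ∀ i, i ≤ ℓ → 0 < D i) (hD1 : ∀ i, i < ℓ → D i ≤ D (i+1))
    {τ : ℝ} (hτ0 : 0 ≤ τ) (hτ4 : τ ≤ 1 / (ℓ:ℝ)^4) {T t0 t1 t2 a1 a2 : ℝ} (hT : 0 < T) (ht0 : 0 < t0) (ht1 : 0 ≤ t1) (ht2 : 0 ≤ t2)
    (ω : Om ℓ D) (x0 p q x : Fin (D 0) → ℝ) (hx0 : nsq x0 = 1) (hp : nsq p = 1)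
    (hqp : nsq (fun j => q j - p j) ≤ a1) (hxq : nsq (fun j => x j - q j) ≤ a2) 
    (hf : ∀ j, fro (ω.1 j) ≤ T) (g1 : GoodP ω.1 τ p x0) (g2 : GoodP ω.1 τ q p)
    (n1 : ω ∉ Stail t1 p x0) (n2 : ω ∉ Stail t2 q p) (n0 : ω ∉ Ssmall t0 x0) (nv : nsq ω.2 ≤ 100) :
    |netOutput ℓ D ω.1 ω.2 x - netOutput ℓ D ω.1 ω.2 x0| ≤
      (t1 * Real.sqrt (A1 / ℓ^2) + t2 * Real.sqrt (8^ℓ * a1 * 2) + 10 * Real.sqrt (k * ((4*T)^ℓ * a2))) / t0 *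
        |netOutput ℓ D ω.1 ω.2 x0| := by
  have hl' : (16:ℝ) ≤ ℓ := by exact_mod_cast hl
  have hτ : τ ≤ 1/8 := by
    refine hτ4.trans (one_div_le_one_div_of_le (by norm_num) ?_)
    have : (16:ℝ)^4 ≤ (ℓ:ℝ)^4 := by gcongr
    linarith
  obtain ⟨c1, c2⟩ := g1.close hl hD hτ0 hτ4 hp hx0
  have l2 := g2.lip hD hτ hp ℓ le_rfl
  have l3 := g1.fine hD hD1 hτ hx0 hT.le hf x q ℓ le_rfl
  have e1 := net_sub ω p x0
  have e2 := net_sub ω q p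
  have e3 := net_sub ω x q
  unfold Stail at n1 n2
  unfold Ssmall at n0
  simp only [Set.mem_ofPred_eq, not_lt] at n1 n2 n0
  rw [← e1] at n1
  rw [← e2] at n2
  have e0 : ∑ j, ω.2 j * hid ω.1 ℓ x0 j = netOutput ℓ D ω.1 ω.2 x0 := rfl
  rw [e0] at n0
  have hs : (((1 / (D ℓ : NNReal) : NNReal)) : ℝ) = 1 / (k:ℝ) := by rw [hDℓ]; simp
  rw [hs] at n1 n2 n0
  have hkr : (0:ℝ) < k := by exact_mod_cast hk
  set R := Real.sqrt (1 / (k:ℝ) * nsq (hid ω.1 ℓ x0)) with hR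
  have hR0 : 0 ≤ R := Real.sqrt_nonneg _
  have hn0 := nsq_nonneg (hid ω.1 ℓ x0)
  have ha1 : 0 ≤ a1 := (nsq_nonneg _).trans hqp
  have ha2 : 0 ≤ a2 := (nsq_nonneg _).trans hxq
  have hA1 : 0 ≤ A1 := by unfold A1; positivity
  have b1 : |netOutput ℓ D ω.1 ω.2 p - netOutput ℓ D ω.1 ω.2 x0| ≤ t1 * Real.sqrt (A1 / ℓ^2) * R := by
    refine n1.trans ?_
    rw [mul_assoc, hR, ← Real.sqrt_mul (by positivity)]
    gcongr t1 * Real.sqrt ?_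
    calc _ ≤ 1 / (k:ℝ) * (A1 / ℓ^2 * nsq (hid ω.1 ℓ x0)) := by gcongr
      _ = _ := by ring
  have b2 : |netOutput ℓ D ω.1 ω.2 q - netOutput ℓ D ω.1 ω.2 p| ≤ t2 * Real.sqrt (8^ℓ * a1 * 2) * R := by
    refine n2.trans ?_
    rw [mul_assoc, hR, ← Real.sqrt_mul (by positivity)]
    gcongr t2 * Real.sqrt ?_
    calc _ ≤ 1 / (k:ℝ) * (8^ℓ * a1 * (2 * nsq (hid ω.1 ℓ x0))) := by
          gcongr
          refine l2.trans ?_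
          have := nsq_nonneg (hid ω.1 ℓ p)
          gcongr
      _ = _ := by ring
  have b3 : |netOutput ℓ D ω.1 ω.2 x - netOutput ℓ D ω.1 ω.2 q| ≤ 10 * Real.sqrt (k * ((4*T)^ℓ * a2)) * R := by
    rw [e3]
    apply abs_le_of_sq_le_sq _ (by positivity)
    have cs := Finset.sum_mul_sq_le_sq_mul_sq Finset.univ ω.2 (fun j => hid ω.1 ℓ x j - hid ω.1 ℓ q j)
    refine cs.trans ?_
    rw [mul_pow, mul_pow, hR, Real.sq_sqrt (by positivity), Real.sq_sqrt (by positivity)]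
    calc nsq ω.2 * nsq (fun j => hid ω.1 ℓ x j - hid ω.1 ℓ q j) ≤ 100 * ((4*T)^ℓ * a2 * nsq (hid ω.1 ℓ x0)) := by
          have := nsq_nonneg (fun j => hid ω.1 ℓ x j - hid ω.1 ℓ q j)
          gcongr
          refine l3.trans ?_
          gcongr
      _ = _ := by field_simp; ring
  have b0 : R ≤ |netOutput ℓ D ω.1 ω.2 x0| / t0 := by
    rw [le_div_iff₀ ht0]; linarith
  set K := t1 * Real.sqrt (A1 / ℓ^2) + t2 * Real.sqrt (8^ℓ * a1 * 2) + 10 * Real.sqrt (k * ((4*T)^ℓ * a2)) with hK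
  have hK0 : 0 ≤ K := by positivity
  have tri : |netOutput ℓ D ω.1 ω.2 x - netOutput ℓ D ω.1 ω.2 x0| ≤ K * R := by
    have : netOutput ℓ D ω.1 ω.2 x - netOutput ℓ D ω.1 ω.2 x0 = (netOutput ℓ D ω.1 ω.2 x - netOutput ℓ D ω.1 ω.2 q) +
      (netOutput ℓ D ω.1 ω.2 q - netOutput ℓ D ω.1 ω.2 p) + (netOutput ℓ D ω.1 ω.2 p - netOutput ℓ D ω.1 ω.2 x0) := by ring
    rw [this]
    refine (abs_add_three _ _ _).trans ?_
    rw [hK]; linarith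
  calc _ ≤ K * R := tri
    _ ≤ K * (|netOutput ℓ D ω.1 ω.2 x0| / t0) := by gcongr
    _ = _ := by ring

end

/-- abstract union bound -/
lemma abs_main {ℓ : ℕ} {D : ℕ → ℕ} (hl : 16 ≤ ℓ) (k : ℕ) (hk : 64 ≤ k) (hD : ∀ i, i ≤ ℓ → 0 < D i)
    (hDk : ∀ i, 1 ≤ i → i ≤ ℓ → D i = k) (hD1 : ∀ i, i < ℓ → D i ≤ D (i+1))
    {τ : ℝ} (hτ0 : 0 ≤ τ) (hτ4 : τ ≤ 1 / (ℓ:ℝ)^4) {T t0 t1 t2 : ℝ} (hT : 0 < T) (ht0 : 0 < t0) (ht1 : 0 ≤ t1) (ht2 : 0 ≤ t2)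
    (x0 : Fin (D 0) → ℝ) (hx0 : nsq x0 = 1) (M1 M2 : ℕ) (hM1 : 0 < M1) (hM2 : 0 < M2) :
    weightMeasure ℓ D {ω | ¬ ∀ x, nsq x = 1 → |netOutput ℓ D ω.1 ω.2 x - netOutput ℓ D ω.1 ω.2 x0| ≤
      (t1 * Real.sqrt (A1 / ℓ^2) + t2 * Real.sqrt (8^ℓ * (D 0 / (M1:ℝ)^2) * 2) +
        10 * Real.sqrt (k * ((4*T)^ℓ * (D 0 / (M2:ℝ)^2)))) / t0 * |netOutput ℓ D ω.1 ω.2 x0|} ≤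
    ℓ * ENNReal.ofReal (k / T) + ((2*M1+1)^(D 0) : ℕ) * (ℓ * (6 * pf k τ)) + ((2*M2+1)^(D 0) : ℕ) * (ℓ * (6 * pf k τ))
     + ((2*M1+1)^(D 0) : ℕ) * ENNReal.ofReal (2 * Real.exp (-t1^2/2))
     + ((2*M2+1)^(D 0) : ℕ) * ENNReal.ofReal (2 * Real.exp (-t2^2/2)) + ENNReal.ofReal t0 + ENNReal.ofReal (1/100) := by
  obtain ⟨N1, hc1, hn1, hN1⟩ := net_exists (D 0) M1 hM1
  obtain ⟨N2, hc2, hn2, hN2⟩ := net_exists (D 0) M2 hM2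
  choose! r hr1 hr2 using hN1
  have hτ1 : τ ≤ 1 := by
    refine hτ4.trans ?_
    have : (16:ℝ) ≤ ℓ := by exact_mod_cast hl
    rw [div_le_one (by positivity)]
    exact one_le_pow₀ (by linarith)
  set E1 : Set (Om ℓ D) := ⋃ j : Fin ℓ, {ω | T < fro (ω.1 j)}
  set E2 : Set (Om ℓ D) := ⋃ p ∈ N1, {ω | ¬ GoodP ω.1 τ p x0}
  set E3 : Set (Om ℓ D) := ⋃ q ∈ N2, {ω | ¬ GoodP ω.1 τ q (r q)}
  set E4 : Set (Om ℓ D) := ⋃ p ∈ N1, Stail t1 p x0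
  set E5 : Set (Om ℓ D) := ⋃ q ∈ N2, Stail t2 q (r q)
  set E6 : Set (Om ℓ D) := Ssmall t0 x0
  set E7 : Set (Om ℓ D) := {ω | 100 < nsq ω.2}
  have hsub : {ω : Om ℓ D | ¬ ∀ x, nsq x = 1 → |netOutput ℓ D ω.1 ω.2 x - netOutput ℓ D ω.1 ω.2 x0| ≤
      (t1 * Real.sqrt (A1 / ℓ^2) + t2 * Real.sqrt (8^ℓ * (D 0 / (M1:ℝ)^2) * 2) +
        10 * Real.sqrt (k * ((4*T)^ℓ * (D 0 / (M2:ℝ)^2)))) / t0 * |netOutput ℓ D ω.1 ω.2 x0|} ⊆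
      E1 ∪ E2 ∪ E3 ∪ E4 ∪ E5 ∪ E6 ∪ E7 := by
    intro ω hω
    by_contra hc
    simp only [Set.mem_union, not_or, E1, E2, E3, E4, E5, E7, Set.mem_iUnion, Set.mem_ofPred_eq, not_exists, not_lt, not_not] at hc
    obtain ⟨⟨⟨⟨⟨⟨h1, h2⟩, h3⟩, h4⟩, h5⟩, h6⟩, h7⟩ := hc
    apply hω
    intro x hx
    obtain ⟨q, hq, hxq⟩ := hN2 x hx
    have hq1 := hn2 q hq
    exact det_concl hl k (by omega) (hDk ℓ (by omega) le_rfl) hD hD1 hτ0 hτ4 hT ht0 ht1 ht2 ω x0 (r q) q x hx0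
      (hn1 _ (hr1 q hq1)) (hr2 q hq1) hxq h1 (h2 _ (hr1 q hq1)) (h3 q hq) (h4 _ (hr1 q hq1)) (h5 q hq) h6 h7
  refine (measure_mono hsub).trans ?_
  refine (measure_union_le _ _).trans (add_le_add ?_ (Sv_le (hD ℓ le_rfl).ne'))
  refine (measure_union_le _ _).trans (add_le_add ?_ (Ssmall_le t0 ht0.le x0))
  refine (measure_union_le _ _).trans (add_le_add ?_ ((biU_le _ N2 _ _ (fun q _ => Stail_le t2 ht2 _ _)).trans (by gcongr)))
  refine (measure_union_le _ _).trans (add_le_add ?_ ((biU_le _ N1 _ _ (fun q _ => Stail_le t1 ht1 _ _)).trans (by gcongr)))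
  refine (measure_union_le _ _).trans (add_le_add ?_ ((biU_le _ N2 _ _ (fun q _ => Sgood_le k hk τ hτ1 hD hDk _ _)).trans (by gcongr)))
  refine (measure_union_le _ _).trans (add_le_add ?_ ((biU_le _ N1 _ _ (fun q _ => Sgood_le k hk τ hτ1 hD hDk _ _)).trans (by gcongr)))
  exact Sfro_le T hT k hD hDk

/-! numerics -/

lemma num_card1 (ℓ d : ℕ) (hl : 1 ≤ ℓ) : (((2 * 8^ℓ + 1)^d : ℕ) : ℝ) ≤ Real.exp (4 * (ℓ * d)) * Real.exp (2 * d) := by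
  have h1 : (2 * (8:ℝ)^ℓ + 1) ≤ Real.exp (3 * ℓ + 2) := by
    have e1 : (8:ℝ) ≤ Real.exp 3 := by
      have := Real.exp_one_gt_d9
      have e : Real.exp 3 = Real.exp 1 ^ 3 := by rw [← Real.exp_nat_mul]; norm_num
      rw [e]
      calc (8:ℝ) = 2^3 := by norm_num
        _ ≤ _ := by gcongr; linarith
    have e2 : (3:ℝ) ≤ Real.exp 2 := by linarith [Real.add_one_le_exp (2:ℝ)]
    have e3 : (1:ℝ) ≤ 8^ℓ := one_le_pow₀ (by norm_num)
    have e4 : (8:ℝ)^ℓ ≤ Real.exp (3 * ℓ) := by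
      rw [mul_comm, Real.exp_nat_mul]; gcongr
    rw [Real.exp_add]
    calc _ ≤ (8:ℝ)^ℓ * 3 := by linarith
      _ ≤ _ := by gcongr
  push_cast
  calc (2 * (8:ℝ)^ℓ + 1)^d ≤ Real.exp (3 * ℓ + 2)^d := by gcongr
    _ = Real.exp (d * (3 * ℓ + 2)) := by rw [← Real.exp_nat_mul]
    _ ≤ Real.exp (4 * (ℓ * d) + 2 * d) := by
      apply Real.exp_le_exp.2
      have : (0:ℝ) ≤ ℓ * d := by positivity
      nlinarith
    _ = _ := Real.exp_add _ _

lemma num_card2 (ℓ d k : ℕ) (hl : 1 ≤ ℓ) (hk : 3 ≤ k) (hd : d^3 ≤ ℓ) (hk2 : (k:ℝ) ≤ Real.exp (Real.sqrt ℓ)) :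
    (((2 * k^(2*ℓ) + 1)^d : ℕ) : ℝ) ≤ Real.exp (3 * ℓ^2) := by
  have hkr : (3:ℝ) ≤ k := by exact_mod_cast hk
  have hlr : (1:ℝ) ≤ ℓ := by exact_mod_cast hl
  have h1 : (2 * (k:ℝ)^(2*ℓ) + 1) ≤ k^(3*ℓ) := by
    have e3 : (1:ℝ) ≤ k^(2*ℓ) := one_le_pow₀ (by linarith)
    calc 2 * (k:ℝ)^(2*ℓ) + 1 ≤ k^(2*ℓ) * 3 := by linarith
      _ ≤ k^(2*ℓ) * k^1 := by gcongr; linarith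
      _ = k^(2*ℓ+1) := by rw [pow_add]
      _ ≤ _ := by gcongr; linarith; omega
  have hds : (d:ℝ) * Real.sqrt ℓ ≤ ℓ := by
    have hd2 : d^2 ≤ ℓ := by
      rcases Nat.eq_zero_or_pos d with h | h
      · simp [h]
      · exact (Nat.pow_le_pow_right h (by norm_num)).trans hd
    have hd2r : (d:ℝ)^2 ≤ ℓ := by exact_mod_cast hd2
    have : (d:ℝ) ≤ Real.sqrt ℓ := Real.le_sqrt_of_sq_le hd2r
    calc (d:ℝ) * Real.sqrt ℓ ≤ Real.sqrt ℓ * Real.sqrt ℓ := by gcongr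
      _ = ℓ := Real.mul_self_sqrt (by positivity)
  push_cast
  calc (2 * (k:ℝ)^(2*ℓ) + 1)^d ≤ ((k:ℝ)^(3*ℓ))^d := by gcongr
    _ ≤ (Real.exp (Real.sqrt ℓ)^(3*ℓ))^d := by gcongr
    _ = Real.exp (3 * ℓ * (d * Real.sqrt ℓ)) := by
      rw [← Real.exp_nat_mul, ← Real.exp_nat_mul]; push_cast; congr 1; ring
    _ ≤ Real.exp (3 * ℓ * ℓ) := by gcongr
    _ = _ := by congr 1; ring

lemma exp_neg5 : Real.exp (-5) ≤ 1/100 := by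
  have h := Real.exp_one_gt_d9
  have e : Real.exp 5 = Real.exp 1 ^ 5 := by rw [← Real.exp_nat_mul]; norm_num
  have : (100:ℝ) ≤ Real.exp 5 := by
    rw [e]
    calc (100:ℝ) ≤ 2.7^5 := by norm_num
      _ ≤ _ := by gcongr; linarith
  rw [Real.exp_neg, ← one_div]
  exact one_div_le_one_div_of_le (by norm_num) this

/-- ofReal packaging -/
lemma ofR (n : ℕ) (r s c : ℝ) (hn : (n:ℝ) ≤ c) (hr : 0 ≤ r) (h : c * r ≤ s) : (n:ENNReal) * ENNReal.ofReal r ≤ ENNReal.ofReal s := by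
  rw [← ENNReal.ofReal_natCast, ← ENNReal.ofReal_mul (by positivity)]
  apply ENNReal.ofReal_le_ofReal
  exact (mul_le_mul_of_nonneg_right hn hr).trans h

/-- the final constant -/
def C1 : ℝ := (4 * Real.sqrt A1 + 2) / (3/100)

lemma C1_pos : 0 < C1 := by unfold C1; positivity

lemma term1 (ℓ d : ℕ) (hd : 0 < d) (hl : d^3 ≤ ℓ) :
    4 * Real.sqrt (ℓ * d) * Real.sqrt (A1 / ℓ^2) ≤ 4 * Real.sqrt A1 / d := by
  have hA1 : 0 ≤ A1 := by unfold A1; positivity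
  have hdr : (0:ℝ) < d := by exact_mod_cast hd
  have hlr : (d:ℝ)^3 ≤ ℓ := by exact_mod_cast hl
  have hl0 : (0:ℝ) < ℓ := lt_of_lt_of_le (by positivity) hlr
  rw [mul_assoc, ← Real.sqrt_mul (by positivity), mul_div_assoc]
  gcongr
  rw [Real.sqrt_le_left (by positivity), div_pow, Real.sq_sqrt hA1]
  have : ℓ * d * (A1 / (ℓ:ℝ)^2) = A1 * (d / ℓ) := by field_simp
  rw [this, div_eq_mul_one_div A1]
  apply mul_le_mul_of_nonneg_left _ hA1
  rw [div_le_div_iff₀ hl0 (by positivity)]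
  nlinarith

lemma pow8 (ℓ : ℕ) (hl : 16 ≤ ℓ) : 32 * (ℓ:ℝ)^3 ≤ 8^ℓ := by
  have h : 4 * ℓ ≤ 2^ℓ := by
    induction ℓ, hl using Nat.le_induction with
    | base => norm_num
    | succ n hn ih => rw [pow_succ]; omega
  have hr : 4 * (ℓ:ℝ) ≤ 2^ℓ := by exact_mod_cast h
  calc 32 * (ℓ:ℝ)^3 ≤ (4 * (ℓ:ℝ))^3 := by
        have : (0:ℝ) ≤ (ℓ:ℝ)^3 := by positivity
        rw [mul_pow]; linarith
    _ ≤ (2^ℓ)^3 := by gcongr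
    _ = 8^ℓ := by rw [← pow_mul, mul_comm, pow_mul]; norm_num

lemma term2 (ℓ d : ℕ) (hd : 0 < d) (hl : d^3 ≤ ℓ) (hl16 : 16 ≤ ℓ) :
    4 * ℓ * Real.sqrt (8^ℓ * (d / (((8^ℓ : ℕ)):ℝ)^2) * 2) ≤ 1 / d := by
  have hdr : (0:ℝ) < d := by exact_mod_cast hd
  have hlr : (d:ℝ)^3 ≤ ℓ := by exact_mod_cast hl
  have hl0 : (0:ℝ) < ℓ := lt_of_lt_of_le (by positivity) hlr
  have h8 := pow8 ℓ hl16
  have : Real.sqrt (8^ℓ * (d / (((8^ℓ : ℕ)):ℝ)^2) * 2) ≤ 1 / (4 * ℓ * d) := by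
    rw [Real.sqrt_le_left (by positivity)]
    push_cast
    rw [show (8:ℝ)^ℓ * (d / ((8:ℝ)^ℓ)^2) * 2 = 2 * d / 8^ℓ by field_simp, div_pow, one_pow, div_le_div_iff₀ (by positivity) (by positivity)]
    calc 2 * (d:ℝ) * (4 * (ℓ:ℝ) * d)^2 = 32 * (ℓ:ℝ)^2 * (d:ℝ)^3 := by ring
      _ ≤ 32 * (ℓ:ℝ)^2 * (ℓ:ℝ) := by gcongr
      _ = 32 * (ℓ:ℝ)^3 := by ring
      _ ≤ _ := by linarith
  calc _ ≤ 4 * (ℓ:ℝ) * (1 / (4 * (ℓ:ℝ) * (d:ℝ))) := by gcongr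
    _ = 1 / (d:ℝ) := by field_simp

lemma term3 (ℓ d k : ℕ) (hd : 0 < d) (hl : 1 ≤ ℓ) (hk0 : 0 < k) (hk : 400 * ℓ ≤ k) (hk2 : 100 * d^3 ≤ k) :
    10 * Real.sqrt (k * ((4*(100 * ℓ * k))^ℓ * (d / (((k^(2*ℓ) : ℕ)):ℝ)^2))) ≤ 1 / d := by
  have hdr : (0:ℝ) < d := by exact_mod_cast hd
  have hkr : (1:ℝ) ≤ k := by exact_mod_cast hk0
  have h1 : (400:ℝ) * ℓ ≤ k := by exact_mod_cast hk
  have h2 : (100:ℝ) * d^3 ≤ k := by exact_mod_cast hk2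
  have hl0 : (0:ℝ) < ℓ := by exact_mod_cast hl
  have : Real.sqrt (k * ((4*(100 * ℓ * k))^ℓ * (d / (((k^(2*ℓ) : ℕ)):ℝ)^2))) ≤ 1 / (10 * d) := by
    rw [Real.sqrt_le_left (by positivity)]
    push_cast
    rw [← pow_mul, div_pow, one_pow, ← mul_div_assoc, ← mul_div_assoc, div_le_div_iff₀ (by positivity) (by positivity)]
    calc (k:ℝ) * ((4*(100 * (ℓ:ℝ) * k))^ℓ * d) * (10 * (d:ℝ))^2 = (k:ℝ) * (400 * (ℓ:ℝ) * k)^ℓ * (100 * (d:ℝ)^3) := by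
          rw [show (4:ℝ)*(100 * ℓ * k) = 400 * ℓ * k by ring]; ring
      _ ≤ (k:ℝ) * ((k:ℝ) * k)^ℓ * k := by gcongr
      _ = (k:ℝ)^(2 * ℓ + 2) := by rw [pow_add, pow_mul]; ring
      _ ≤ (k:ℝ)^(2 * ℓ * 2) := pow_le_pow_right₀ hkr (by omega)
      _ = 1 * (k:ℝ)^(2 * ℓ * 2) := by ring
  calc _ ≤ 10 * (1 / (10 * (d:ℝ))) := by gcongr
    _ = 1 / d := by field_simp

lemma concl_ratio {f0 fx fy δ : ℝ} (hδ : δ ≤ 1/2) (hδ0 : 0 ≤ δ) (hx : |fx - f0| ≤ δ * |f0|) (hy : |fy - f0| ≤ δ * |f0|) :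
    |fx - fy| / |fx| ≤ 4 * δ := by
  have h0 := abs_nonneg f0
  have h1 : |f0| / 2 ≤ |fx| := by
    have := abs_sub_abs_le_abs_sub f0 fx
    rw [abs_sub_comm] at this
    nlinarith
  have h2 : |fx - fy| ≤ 2 * δ * |f0| := by
    have : fx - fy = (fx - f0) - (fy - f0) := by ring
    rw [this]
    refine (abs_sub _ _).trans ?_
    linarith
  rcases eq_or_lt_of_le (abs_nonneg fx) with h | h
  · rw [← h, div_zero]; positivity
  · rw [div_le_iff₀ h]
    nlinarith

lemma log_bound (d : ℕ) (hd : 3 ≤ d) : 1 / (d:ℝ) ≤ Real.sqrt (Real.log d / d) := by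
  have hdr : (3:ℝ) ≤ d := by exact_mod_cast hd
  apply Real.le_sqrt_of_sq_le
  have : 1 ≤ Real.log d := by
    rw [Real.le_log_iff_exp_le (by linarith)]
    linarith [Real.exp_one_lt_d9]
  rw [div_pow, one_pow, div_le_div_iff₀ (by positivity) (by positivity)]
  nlinarith

lemma prob_num (ℓ d k : ℕ) (hd : 100 ≤ d) (hdK : Kc ≤ d) (hl : d^3 ≤ ℓ) (hk : (ℓ*d)^20 ≤ k) (hk2 : (k:ℝ) ≤ Real.exp (Real.sqrt ℓ)) :
    ℓ * ENNReal.ofReal (k / (100 * ℓ * k)) + ((2*8^ℓ+1)^d : ℕ) * (ℓ * (6 * pf k (1 / (ℓ:ℝ)^4))) + ((2*k^(2*ℓ)+1)^d : ℕ) * (ℓ * (6 * pf k (1 / (ℓ:ℝ)^4)))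
     + ((2*8^ℓ+1)^d : ℕ) * ENNReal.ofReal (2 * Real.exp (-(4 * Real.sqrt (ℓ * d))^2/2))
     + ((2*k^(2*ℓ)+1)^d : ℕ) * ENNReal.ofReal (2 * Real.exp (-(4 * ℓ)^2/2)) + ENNReal.ofReal (3/100) + ENNReal.ofReal (1/100) ≤ ENNReal.ofReal (1/10) := by
  have hdr : (100:ℝ) ≤ d := by exact_mod_cast hd
  have hl3 : (d:ℝ)^3 ≤ ℓ := by exact_mod_cast hl
  have hld : 100 * (d:ℝ) ≤ ℓ := by nlinarith [sq_nonneg (d:ℝ)]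
  have hlr : (10000:ℝ) ≤ ℓ := by linarith
  have hl1 : 1 ≤ ℓ := by
    have : (1:ℝ) ≤ ℓ := by linarith
    exact_mod_cast this
  have hldn : 1 ≤ ℓ * d := Nat.mul_pos (by omega) (by omega)
  have hk3 : 3 ≤ k := by
    calc 3 ≤ ℓ * d := by nlinarith
      _ = (ℓ*d)^1 := by ring
      _ ≤ (ℓ*d)^20 := Nat.pow_le_pow_right hldn (by norm_num)
      _ ≤ k := hk
  have hkr : (0:ℝ) < k := by have : 0 < k := by omega
                             exact_mod_cast this
  have hexp : (ℓ:ℝ)^6 ≤ Real.sqrt k * (1 / (ℓ:ℝ)^4) := by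
    have h1 : (ℓ:ℝ)^10 ≤ Real.sqrt k := by
      apply Real.le_sqrt_of_sq_le
      have : (((ℓ*d)^20 : ℕ):ℝ) ≤ k := by exact_mod_cast hk
      push_cast at this
      rw [mul_pow] at this
      have h1d : (1:ℝ) ≤ (d:ℝ)^20 := one_le_pow₀ (by linarith)
      have : ((ℓ:ℝ)^10)^2 = ℓ^20 := by ring
      have h0 : (0:ℝ) ≤ (ℓ:ℝ)^20 := by positivity
      nlinarith
    rw [mul_one_div, le_div_iff₀ (by positivity), ← pow_add]
    exact h1
  have c1 := num_card1 ℓ d hl1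
  rw [← Real.exp_add] at c1
  have c2 := num_card2 ℓ d k hl1 hk3 hl hk2
  have c1' : (((2 * 8^ℓ + 1)^d : ℕ) : ℝ) ≤ Real.exp (3 * ℓ^2) := by
    refine c1.trans (Real.exp_le_exp.2 ?_)
    nlinarith
  have hpf : (ℓ:ENNReal) * (6 * pf k (1 / (ℓ:ℝ)^4)) = ENNReal.ofReal (ℓ * (6 * Real.exp (Kc - Real.sqrt k * (1 / (ℓ:ℝ)^4)))) := by
    unfold pf
    rw [ENNReal.ofReal_mul (by positivity), ENNReal.ofReal_mul (by norm_num), ENNReal.ofReal_natCast]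
    simp
  rw [hpf]
  have hB : Real.exp (3 * ℓ^2) * (ℓ * (6 * Real.exp (Kc - Real.sqrt k * (1 / (ℓ:ℝ)^4)))) ≤ 1/100 := by
    have e1 : (ℓ:ℝ) ≤ Real.exp ℓ := by linarith [Real.add_one_le_exp (ℓ:ℝ)]
    have e2 : (6:ℝ) ≤ Real.exp 5 := by linarith [Real.add_one_le_exp (5:ℝ)]
    calc _ ≤ Real.exp (3 * ℓ^2) * (Real.exp ℓ * (Real.exp 5 * Real.exp (Kc - Real.sqrt k * (1 / (ℓ:ℝ)^4)))) := by gcongr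
      _ = Real.exp (3 * ℓ^2 + (ℓ + (5 + (Kc - Real.sqrt k * (1 / (ℓ:ℝ)^4))))) := by rw [← Real.exp_add, ← Real.exp_add, ← Real.exp_add]
      _ ≤ Real.exp (-5) := by
        apply Real.exp_le_exp.2
        have h6 : (ℓ:ℝ)^2 * 10 ≤ (ℓ:ℝ)^6 := by
          have : (10:ℝ) ≤ (ℓ:ℝ)^4 := by
            calc (10:ℝ) ≤ 10000^4 := by norm_num
              _ ≤ _ := by gcongr
          calc (ℓ:ℝ)^2 * 10 ≤ (ℓ:ℝ)^2 * (ℓ:ℝ)^4 := by gcongr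
            _ = _ := by ring
        nlinarith
      _ ≤ _ := exp_neg5
  have s1 := ofR ℓ (k / (100 * ℓ * k)) (1/100) ℓ le_rfl (by positivity) (le_of_eq (by field_simp))
  have s2 := ofR _ (ℓ * (6 * Real.exp (Kc - Real.sqrt k * (1 / (ℓ:ℝ)^4)))) (1/100) _ c1' (by positivity) hB
  have s3 := ofR _ (ℓ * (6 * Real.exp (Kc - Real.sqrt k * (1 / (ℓ:ℝ)^4)))) (1/100) _ c2 (by positivity) hB
  have two : (2:ℝ) ≤ Real.exp 1 := by linarith [Real.add_one_le_exp (1:ℝ)]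
  have s4 := ofR _ (2 * Real.exp (-(4 * Real.sqrt (ℓ * d))^2/2)) (1/100) _ c1 (by positivity) (by
    calc _ ≤ Real.exp (4 * (ℓ * d) + 2 * d) * (Real.exp 1 * Real.exp (-(4 * Real.sqrt (ℓ * d))^2/2)) := by gcongr
      _ = Real.exp (4 * (ℓ * d) + 2 * d + (1 + -(4 * Real.sqrt (ℓ * d))^2/2)) := by rw [← Real.exp_add, ← Real.exp_add]
      _ ≤ Real.exp (-5) := by
        apply Real.exp_le_exp.2
        rw [mul_pow, Real.sq_sqrt (by positivity)]
        nlinarith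
      _ ≤ _ := exp_neg5)
  have s5 := ofR _ (2 * Real.exp (-(4 * (ℓ:ℝ))^2/2)) (1/100) _ c2 (by positivity) (by
    calc _ ≤ Real.exp (3 * ℓ^2) * (Real.exp 1 * Real.exp (-(4 * (ℓ:ℝ))^2/2)) := by gcongr
      _ = Real.exp (3 * ℓ^2 + (1 + -(4 * (ℓ:ℝ))^2/2)) := by rw [← Real.exp_add, ← Real.exp_add]
      _ ≤ Real.exp (-5) := by
        apply Real.exp_le_exp.2
        nlinarith
      _ ≤ _ := exp_neg5)
  calc _ ≤ ENNReal.ofReal (1/100) + ENNReal.ofReal (1/100) + ENNReal.ofReal (1/100) + ENNReal.ofReal (1/100) + ENNReal.ofReal (1/100)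
        + ENNReal.ofReal (3/100) + ENNReal.ofReal (1/100) := by gcongr
    _ = ENNReal.ofReal (9/100) := by
      rw [← ENNReal.ofReal_add, ← ENNReal.ofReal_add, ← ENNReal.ofReal_add, ← ENNReal.ofReal_add, ← ENNReal.ofReal_add, ← ENNReal.ofReal_add] <;> norm_num
    _ ≤ _ := ENNReal.ofReal_le_ofReal (by norm_num)

/-- Theorem 2 of the paper: for sufficiently deep random ReLU networks with
constant width `k`, `(ℓd)^{20} ≤ k ≤ exp(√ℓ)`, with probability at least `0.9` the relative
variation of the output over the unit sphere is at most `C √(log d / d)`. -/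
theorem stmt1 :
    ∃ C : ℝ, 0 < C ∧ ∃ d₀ : ℕ, ∀ d : ℕ, d₀ ≤ d →
      ∀ ℓ : ℕ, d ^ 3 ≤ ℓ →
      ∀ k : ℕ, (ℓ * d) ^ 20 ≤ k → (k : ℝ) ≤ Real.exp (Real.sqrt ℓ) →
      ∀ D : ℕ → ℕ, D 0 = d → (∀ i : ℕ, 1 ≤ i → i ≤ ℓ → D i = k) →
        weightMeasure ℓ D {ω | ∀ x y : Fin (D 0) → ℝ, evNorm x = 1 → evNorm y = 1 →
            |netOutput ℓ D ω.1 ω.2 x - netOutput ℓ D ω.1 ω.2 y| / |netOutput ℓ D ω.1 ω.2 x| ≤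
              C * Real.sqrt (Real.log d / d)} ≥
          ENNReal.ofReal 0.9 := by
  refine ⟨4 * C1, by have := C1_pos; positivity, max 100 (max ⌈Kc⌉₊ ⌈2 * C1⌉₊), ?_⟩
  intro d hd ℓ hl k hk hk2 D hD0 hDk
  have hd100 : 100 ≤ d := (le_max_left _ _).trans hd
  have hdK : Kc ≤ d := (Nat.le_ceil _).trans (by exact_mod_cast ((le_max_left _ _).trans (le_max_right _ _)).trans hd)
  have hdC : 2 * C1 ≤ d := (Nat.le_ceil _).trans (by exact_mod_cast ((le_max_right _ _).trans (le_max_right _ _)).trans hd)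
  have hld : 10000 * d ≤ ℓ := by
    calc 10000 * d = 100 * 100 * d := by ring
      _ ≤ d * d * d := by gcongr
      _ = d^3 := by ring
      _ ≤ ℓ := hl
  have hl16 : 16 ≤ ℓ := by omega
  have hldp : 1 ≤ ℓ * d := Nat.mul_pos (by omega) (by omega)
  have hk2' : (ℓ * d)^2 ≤ k := (Nat.pow_le_pow_right hldp (by norm_num)).trans hk
  have hkl : 400 * ℓ ≤ k := by
    calc 400 * ℓ ≤ (d * d * ℓ) * ℓ := by
          have : 400 ≤ d * d * ℓ := by nlinarith
          gcongr
      _ = (ℓ*d)^2 := by ring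
      _ ≤ k := hk2'
  have hkd : 100 * d^3 ≤ k := by omega
  have hkdd : d ≤ k := by omega
  have hDpos : ∀ i, i ≤ ℓ → 0 < D i := by
    intro i hi
    rcases Nat.eq_zero_or_pos i with h | h
    · rw [h, hD0]; omega
    · rw [hDk i h hi]; omega
  have hD1 : ∀ i, i < ℓ → D i ≤ D (i+1) := by
    intro i hi
    rw [hDk (i+1) (by omega) hi]
    rcases Nat.eq_zero_or_pos i with h | h
    · rw [h, hD0]; omega
    · rw [hDk i h hi.le]
  have hdr : (100:ℝ) ≤ d := by exact_mod_cast hd100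
  have hlr : (0:ℝ) < ℓ := by have : 0 < ℓ := by omega
                             exact_mod_cast this
  have hkr : (0:ℝ) < k := by have : 0 < k := by omega
                             exact_mod_cast this
  set x0 : Fin (D 0) → ℝ := Pi.single ⟨0, hDpos 0 (by omega)⟩ 1 with hx0
  have hx0n : nsq x0 = 1 := by
    unfold nsq
    rw [Finset.sum_eq_single ⟨0, hDpos 0 (by omega)⟩] <;> simp +contextual [hx0]
  have main := abs_main hl16 k (by omega) hDpos hDk hD1 (τ := 1 / (ℓ:ℝ)^4) (by positivity) le_rfl (T := 100 * ℓ * k)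
    (t0 := 3/100) (t1 := 4 * Real.sqrt (ℓ * d)) (t2 := 4 * ℓ) (by positivity) (by norm_num) (by positivity) (by positivity)
    x0 hx0n (8^ℓ) (k^(2*ℓ)) (by positivity) (Nat.pow_pos (by omega))
  have pn := prob_num ℓ d k hd100 hdK hl hk hk2
  set Bad := {ω : Om ℓ D | ¬ ∀ x, nsq x = 1 → |netOutput ℓ D ω.1 ω.2 x - netOutput ℓ D ω.1 ω.2 x0| ≤
      (4 * Real.sqrt (ℓ * d) * Real.sqrt (A1 / ℓ^2) + 4 * ℓ * Real.sqrt (8^ℓ * (D 0 / (((8^ℓ : ℕ)):ℝ)^2) * 2) +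
        10 * Real.sqrt (k * ((4*(100 * ℓ * k))^ℓ * (D 0 / (((k^(2*ℓ) : ℕ)):ℝ)^2)))) / (3/100) * |netOutput ℓ D ω.1 ω.2 x0|} with hBad
  have hb : weightMeasure ℓ D Bad ≤ ENNReal.ofReal (1/10) := by
    refine main.trans ?_
    rw [hD0]
    exact pn
  set Good := {ω : Om ℓ D | ∀ x y : Fin (D 0) → ℝ, evNorm x = 1 → evNorm y = 1 →
            |netOutput ℓ D ω.1 ω.2 x - netOutput ℓ D ω.1 ω.2 y| / |netOutput ℓ D ω.1 ω.2 x| ≤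
              4 * C1 * Real.sqrt (Real.log d / d)} with hGood
  have hcover : Set.univ ⊆ Good ∪ Bad := by
    intro ω _
    by_cases h : ω ∈ Bad
    · exact Or.inr h
    left
    simp only [hBad, Set.mem_ofPred_eq, not_not] at h
    have key : ∀ x, evNorm x = 1 → |netOutput ℓ D ω.1 ω.2 x - netOutput ℓ D ω.1 ω.2 x0| ≤ C1 / d * |netOutput ℓ D ω.1 ω.2 x0| := by
      intro x hx
      have hx1 : nsq x = 1 := by
        have : Real.sqrt (nsq x) = 1 := hx
        rwa [Real.sqrt_eq_one] at this
      refine (h x hx1).trans ?_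
      have t1 := term1 ℓ d (by omega) hl
      have t2 := term2 ℓ d (by omega) hl hl16
      have t3 := term3 ℓ d k (by omega) (by omega) (by omega) hkl hkd
      rw [hD0]
      apply mul_le_mul_of_nonneg_right _ (abs_nonneg _)
      have : C1 / d = (4 * Real.sqrt A1 / d + 1 / d + 1 / d) / (3/100) := by
        unfold C1; field_simp; ring
      rw [this]
      apply div_le_div_of_nonneg_right _ (by norm_num)
      linarith
    intro x y hx hy
    have hC := C1_pos
    have hδ : C1 / d ≤ 1/2 := by rw [div_le_iff₀ (by linarith)]; linarith
    refine (concl_ratio hδ (by positivity) (key x hx) (key y hy)).trans ?_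
    have := log_bound d (by omega)
    calc 4 * (C1 / d) = 4 * C1 * (1 / d) := by ring
      _ ≤ _ := by gcongr
  have : IsProbabilityMeasure (weightMeasure ℓ D) := by rw [wm_eq]; infer_instance
  have h1 : 1 ≤ weightMeasure ℓ D Good + ENNReal.ofReal (1/10) := by
    calc (1:ENNReal) = weightMeasure ℓ D Set.univ := measure_univ.symm
      _ ≤ weightMeasure ℓ D (Good ∪ Bad) := measure_mono hcover
      _ ≤ weightMeasure ℓ D Good + weightMeasure ℓ D Bad := measure_union_le _ _
      _ ≤ _ := by gcongr
  have h2 : (1:ENNReal) = ENNReal.ofReal 0.9 + ENNReal.ofReal (1/10) := by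
    rw [← ENNReal.ofReal_add] <;> norm_num
  rw [h2] at h1
  exact (ENNReal.add_le_add_iff_right ENNReal.ofReal_ne_top).1 h1

end
end

section
/- In the setting of the random ReLU network with fixed input x ≠ 0, let α₁, …, α_ℓ ∈ (0,1) and δ ∈ (0,1), and assume for each i ∈ [ℓ] that α_i ≥ c √(log(ℓ/δ)/d_{i+1}) for a suitable absolute constant c. Then with probability at least 1 − δ, for all i ∈ [ℓ]: #{ j : |⟨(W_{i+1})_j, f_i(x)⟩| ≥ α_i ‖f_i(x)‖/√(d_i) } ≥ (1 − 2√(2/π) α_i) d_{i+1}. -/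
open MeasureTheory ProbabilityTheory

noncomputable section

open scoped ENNReal NNReal

lemma pi_le_of_section {ι : Type*} [Fintype ι] [DecidableEq ι] {X : ι → Type*}
    [∀ i, MeasurableSpace (X i)] (μ : ∀ i, Measure (X i)) [∀ i, IsProbabilityMeasure (μ i)]
    (i : ι) (S : Set (∀ i, X i)) (hS : MeasurableSet S) (ε : ℝ≥0∞)
    (h : ∀ x, μ i {y | Function.update x i y ∈ S} ≤ ε) : Measure.pi μ S ≤ ε := by
  have h1 := lintegral_le_of_lmarginal_le (μ := μ) {i} (f := S.indicator 1) (g := fun _ => ε)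
    (measurable_one.indicator hS) measurable_const (by
      rw [lmarginal_singleton, lmarginal_singleton]
      intro x
      have hm : MeasurableSet {y | Function.update x i y ∈ S} := (measurable_update x) hS
      have : (fun y => S.indicator (1 : (∀ i, X i) → ℝ≥0∞) (Function.update x i y)) =
          ({y | Function.update x i y ∈ S}).indicator 1 := by
        ext y; simp [Set.indicator]
      simp only [this, lintegral_indicator_one hm, lintegral_const, measure_univ, mul_one]
      exact h x)
  simpa [lintegral_indicator_one hS] using h1

lemma map_lin_gauss {m : ℕ} (s : ℝ≥0) (v : Fin m → ℝ) :
    (Measure.pi fun _ : Fin m => gaussianReal 0 s).map (fun u => ∑ k, u k * v k) =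
      gaussianReal 0 (s * ∑ k, (v k ^ 2).toNNReal) := by
  have hm : Measurable (fun u : Fin m → ℝ => ∑ k, u k * v k) := by fun_prop
  have : IsProbabilityMeasure ((Measure.pi fun _ : Fin m => gaussianReal 0 s).map
      (fun u => ∑ k, u k * v k)) :=
    Measure.isProbabilityMeasure_map hm.aemeasurable
  apply Measure.ext_of_charFun
  ext t
  rw [charFun_gaussianReal, charFun_apply_real, integral_map hm.aemeasurable (by fun_prop)]
  have e : ∀ u : Fin m → ℝ, Complex.exp (t * ((∑ k, u k * v k : ℝ) : ℂ) * Complex.I) =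
      ∏ k, Complex.exp (((t * v k : ℝ) : ℂ) * (u k : ℂ) * Complex.I) := by
    intro u
    rw [← Complex.exp_sum]
    congr 1
    push_cast
    rw [Finset.mul_sum, Finset.sum_mul]
    exact Finset.sum_congr rfl fun k _ => by ring
  simp_rw [e]
  rw [integral_fintype_prod_eq_prod (fun k (x : ℝ) => Complex.exp (((t * v k : ℝ) : ℂ) * (x : ℂ) * Complex.I))]
  simp_rw [← charFun_apply_real, charFun_gaussianReal]
  rw [← Complex.exp_sum]
  congr 1
  push_cast
  simp only [Real.coe_toNNReal _ (sq_nonneg _), mul_zero, zero_mul, zero_sub]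
  rw [Finset.mul_sum, Finset.sum_mul, Finset.sum_div, ← Finset.sum_neg_distrib]
  refine Finset.sum_congr rfl fun k _ => by 
    push_cast
    ring

lemma gauss_small (s : ℝ≥0) (hs : s ≠ 0) (α : ℝ) (hα : 0 ≤ α) :
    gaussianReal 0 s {y | |y| < α * Real.sqrt s} ≤ ENNReal.ofReal (Real.sqrt (2 / Real.pi) * α) := by
  have hs' : (0:ℝ) < s := by positivity
  rw [gaussianReal_apply _ hs]
  calc ∫⁻ y in {y | |y| < α * Real.sqrt s}, gaussianPDF 0 s y
      ≤ ∫⁻ y in {y | |y| < α * Real.sqrt s}, ENNReal.ofReal ((Real.sqrt (2 * Real.pi * s))⁻¹) := by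
        apply lintegral_mono
        intro y
        rw [gaussianPDF_def]
        apply ENNReal.ofReal_le_ofReal
        rw [gaussianPDFReal_def]
        apply mul_le_of_le_one_right (by positivity)
        rw [Real.exp_le_one_iff]
        have : 0 ≤ (y - 0)^2 / (2 * (s:ℝ)) := by positivity
        rw [neg_div]; linarith
    _ = _ := by
        have : {y : ℝ | |y| < α * Real.sqrt s} = Set.Ioo (-(α * Real.sqrt s)) (α * Real.sqrt s) := by
          ext y; simp [abs_lt]
        rw [this, setLIntegral_const, Real.volume_Ioo, ← ENNReal.ofReal_mul (by positivity)]
        congr 1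
        rw [Real.sqrt_mul (by positivity), Real.sqrt_mul (by positivity),
          Real.sqrt_div (by positivity)]
        have h2 : Real.sqrt 2 ^ 2 = 2 := Real.sq_sqrt (by norm_num)
        have : Real.sqrt s ≠ 0 := by positivity
        have : Real.sqrt Real.pi ≠ 0 := by positivity
        field_simp
        rw [h2]; ring

lemma evNorm_sq {n : ℕ} (v : Fin n → ℝ) : evNorm v ^ 2 = ∑ i, v i ^ 2 :=
  Real.sq_sqrt (by positivity)

lemma row_small_s6 {m : ℕ} (v : Fin m → ℝ) (α : ℝ) (hα : 0 ≤ α) :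
    (Measure.pi fun _ : Fin m => gaussianReal 0 (1 / (m : ℝ≥0)))
      {u | |∑ k, u k * v k| < α * evNorm v / Real.sqrt m} ≤
      ENNReal.ofReal (Real.sqrt (2 / Real.pi) * α) := by
  by_cases h0 : α * evNorm v / Real.sqrt m ≤ 0
  · have : {u : Fin m → ℝ | |∑ k, u k * v k| < α * evNorm v / Real.sqrt m} = ∅ := by
      ext u
      simp only [Set.mem_ofPred_eq, Set.mem_empty_iff_false, iff_false, not_lt]
      exact h0.trans (abs_nonneg _)
    rw [this]; simp
  have hm : (m : ℝ) ≠ 0 := by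
    intro h; apply h0; simp [h]
  have hv : evNorm v ≠ 0 := by
    intro h; apply h0; simp [h]
  have hm' : (m : ℝ≥0) ≠ 0 := by exact_mod_cast hm
  set s : ℝ≥0 := 1 / (m : ℝ≥0) * ∑ k, (v k ^ 2).toNNReal with hs
  have hsR : (s : ℝ) = evNorm v ^ 2 / m := by
    rw [hs, evNorm_sq]; push_cast; simp only [Real.coe_toNNReal _ (sq_nonneg _)]; ring
  have hs0 : s ≠ 0 := by
    intro h
    have : (s:ℝ) = 0 := by simp [h]
    rw [hsR] at this
    have : evNorm v ^ 2 / m ≠ 0 := by positivity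
    contradiction
  have hsq : Real.sqrt s = evNorm v / Real.sqrt m := by
    rw [hsR, Real.sqrt_div (by positivity), Real.sqrt_sq (show 0 ≤ evNorm v from Real.sqrt_nonneg _)]
  have := gauss_small s hs0 α hα
  rw [hs, ← map_lin_gauss, Measure.map_apply (by fun_prop)
    (measurableSet_lt (by fun_prop) (by fun_prop)), ← hs, hsq, ← mul_div_assoc] at this
  exact this

lemma hoeff {Ω : Type*} [MeasurableSpace Ω] (ν : Measure Ω) [IsProbabilityMeasure ν] (n : ℕ)
    (hn : n ≠ 0) (B : Set Ω) (hB : MeasurableSet B) (p : ℝ) (hp : 0 ≤ p) 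
    (hνB : ν B ≤ ENNReal.ofReal p) :
    (Measure.pi fun _ : Fin n => ν) {y | 2 * p * n ≤ ∑ j, B.indicator (fun _ => (1:ℝ)) (y j)} ≤
      ENNReal.ofReal (Real.exp (-(2 * p^2 * n))) := by
  set X : Ω → ℝ := B.indicator (fun _ => (1:ℝ)) with hX
  have hXm : Measurable X := measurable_const.indicator hB
  have hXi : ν[X] ≤ p := by
    rw [hX, integral_indicator_const _ hB, smul_eq_mul, mul_one]
    exact ENNReal.toReal_le_of_le_ofReal hp hνB
  have hind : iIndepFun (fun (i : Fin n) (ω : Fin n → Ω) => X (ω i) - ν[X]) 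
      (Measure.pi fun _ : Fin n => ν) := 
    iIndepFun_pi (X := fun _ ω => X ω - ν[X]) (fun i => (hXm.sub_const _).aemeasurable)
  have hsub : ∀ i ∈ (Finset.univ : Finset (Fin n)),
      HasSubgaussianMGF (fun ω : Fin n → Ω => X (ω i) - ν[X]) ((‖(1:ℝ) - 0‖₊ / 2) ^ 2)
        (Measure.pi fun _ : Fin n => ν) := by
    intro i _
    have h := hasSubgaussianMGF_of_mem_Icc (μ := Measure.pi fun _ : Fin n => ν)
      (X := fun ω => X (ω i)) (a := 0) (b := 1) (hXm.comp (measurable_pi_apply i)).aemeasurable (by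
        refine Filter.Eventually.of_forall fun ω => ?_
        by_cases hh : ω i ∈ B <;> simp [hX, hh])
    have e : ∫ ω, X (ω i) ∂(Measure.pi fun _ : Fin n => ν) = ν[X] :=
      integral_comp_eval (μ := fun _ : Fin n => ν) hXm.aestronglyMeasurable
    rwa [e] at h
  have key := HasSubgaussianMGF.measure_sum_ge_le_of_iIndepFun hind hsub (ε := p * n) (by positivity)
  have hn' : (0:ℝ) < n := by positivity
  calc (Measure.pi fun _ : Fin n => ν) {y | 2 * p * n ≤ ∑ j, X (y j)}
      ≤ (Measure.pi fun _ : Fin n => ν) {ω | p * n ≤ ∑ i, (X (ω i) - ν[X])} := by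
        apply measure_mono
        intro y hy
        simp only [Set.mem_ofPred_eq, Finset.sum_sub_distrib, Finset.sum_const, Finset.card_univ,
          Fintype.card_fin, nsmul_eq_mul] at hy ⊢
        nlinarith
    _ ≤ _ := by
        rw [← ofReal_measureReal]
        apply ENNReal.ofReal_le_ofReal
        refine key.trans (le_of_eq ?_)
        congr 1
        simp
        field_simp

lemma ncard_eq {n : ℕ} {Ω : Type*} (B : Set Ω) (y : Fin n → Ω) :
    ((Set.ncard {j | y j ∉ B} : ℕ) : ℝ) = n - ∑ j, B.indicator (fun _ => (1:ℝ)) (y j) := by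
  classical
  have h1 : (∑ j, B.indicator (fun _ => (1:ℝ)) (y j)) = (Set.ncard {j | y j ∈ B} : ℕ) := by
    rw [Set.ncard_eq_toFinset_card']
    simp [Set.indicator]
  have h2 := Set.ncard_add_ncard_compl {j : Fin n | y j ∈ B}
  rw [h1, eq_sub_iff_add_eq]
  rw [Nat.card_eq_fintype_card, Fintype.card_fin] at h2
  rw [← Nat.cast_add, Nat.cast_inj, add_comm]
  exact h2

lemma layer_bound {n m : ℕ} (hn : n ≠ 0) (v : Fin m → ℝ) (α : ℝ) (hα : 0 ≤ α) :
    gaussMat n m (1 / (m : ℝ≥0)) {y | ¬ (((Set.ncard {j : Fin n |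
      |∑ k, y j k * v k| ≥ α * evNorm v / Real.sqrt m} : ℕ) : ℝ) ≥
        (1 - 2 * Real.sqrt (2 / Real.pi) * α) * n)} ≤
      ENNReal.ofReal (Real.exp (-(α^2 * n))) := by
  set B : Set (Fin m → ℝ) := {u | |∑ k, u k * v k| < α * evNorm v / Real.sqrt m} with hBdef
  have hB : MeasurableSet B := measurableSet_lt (by fun_prop) (by fun_prop)
  have h := hoeff (Measure.pi fun _ : Fin m => gaussianReal 0 (1 / (m : ℝ≥0))) n hn B hB
    (Real.sqrt (2 / Real.pi) * α) (by positivity) (row_small_s6 v α hα)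
  refine le_trans (measure_mono ?_) (h.trans ?_)
  · intro y hy
    have e : {j : Fin n | |∑ k, y j k * v k| ≥ α * evNorm v / Real.sqrt m} = {j | y j ∉ B} := by
      ext j; simp [hBdef]
    simp only [Set.mem_ofPred_eq] at hy ⊢
    rw [e, ncard_eq] at hy
    push Not at hy
    nlinarith
  · apply ENNReal.ofReal_le_ofReal
    apply Real.exp_le_exp.2
    rw [mul_pow, Real.sq_sqrt (by positivity), neg_le_neg_iff]
    have h1 : 1 ≤ 2 * (2 / Real.pi) := by
      have := Real.pi_le_four
      have := Real.pi_pos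
      rw [← mul_div_assoc, le_div_iff₀ this]; linarith
    have h2 : 0 ≤ α^2 * n := by positivity
    nlinarith

lemma forward_congr (D : ℕ → ℕ) (w w' : ∀ i : ℕ, Fin (D (i+1)) → Fin (D i) → ℝ)
    (x : Fin (D 0) → ℝ) : ∀ i, (∀ k < i, w k = w' k) → forward D w i x = forward D w' i x
  | 0, _ => rfl
  | i+1, h => by
    ext j
    simp only [forward]
    rw [forward_congr D w w' x i (fun k hk => h k (by omega)), h i (by omega)]

lemma extendW_meas (L : ℕ) (D : ℕ → ℕ) (i : ℕ) (j) (k) :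
    Measurable (fun w => extendW L D w i j k) := by
  unfold extendW
  by_cases h : i < L
  · simp only [h, dite_true]; fun_prop
  · simp only [h, dite_false]; fun_prop

lemma forward_meas (L : ℕ) (D : ℕ → ℕ) (x : Fin (D 0) → ℝ) : ∀ i (j : Fin (D i)),
    Measurable (fun w => forward D (extendW L D w) i x j)
  | 0, _ => by simp only [forward]; fun_prop
  | i+1, j => by
    simp only [forward]
    exact (Finset.measurable_sum _ fun k _ =>
      (extendW_meas L D i j k).mul (forward_meas L D x i k)).max measurable_const

lemma bad_layer (ℓ : ℕ) (D : ℕ → ℕ) (x : Fin (D 0) → ℝ) (i : ℕ) (hi : i ≤ ℓ) (a : ℝ)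
    (ha : 0 ≤ a) (hn : D (i+1) ≠ 0) :
    hiddenMeasure (ℓ+1) D {w | ¬ ((Set.ncard {j : Fin (D (i+1)) |
                |preact D (extendW (ℓ+1) D w) i x j| ≥
                  a * evNorm (forward D (extendW (ℓ+1) D w) i x) / Real.sqrt (D i)} : ℝ) ≥
              (1 - 2 * Real.sqrt (2 / Real.pi) * a) * (D (i+1) : ℝ))} ≤ 
      ENNReal.ofReal (Real.exp (-(a^2 * D (i+1)))) := by
  unfold hiddenMeasure
  apply pi_le_of_section _ (⟨i, by omega⟩ : Fin (ℓ+1))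
  · suffices hgood : MeasurableSet {w | ((Set.ncard {j : Fin (D (i+1)) |
                |preact D (extendW (ℓ+1) D w) i x j| ≥
                  a * evNorm (forward D (extendW (ℓ+1) D w) i x) / Real.sqrt (D i)} : ℕ) : ℝ) ≥
              (1 - 2 * Real.sqrt (2 / Real.pi) * a) * (D (i+1) : ℝ)} from hgood.compl
    have e : ∀ w, ((Set.ncard {j : Fin (D (i+1)) |
                |preact D (extendW (ℓ+1) D w) i x j| ≥
                  a * evNorm (forward D (extendW (ℓ+1) D w) i x) / Real.sqrt (D i)} : ℕ) : ℝ) =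
        ∑ j, Set.indicator {w | |preact D (extendW (ℓ+1) D w) i x j| ≥
                  a * evNorm (forward D (extendW (ℓ+1) D w) i x) / Real.sqrt (D i)}
                  (fun _ => (1:ℝ)) w := by
      intro w
      classical
      rw [Set.ncard_eq_toFinset_card']
      simp [Set.indicator]
    simp_rw [e]
    refine measurableSet_le measurable_const ?_
    refine Finset.measurable_sum _ fun j _ => ?_
    refine Measurable.indicator measurable_const ?_
    refine measurableSet_le (f := fun w => a * evNorm (forward D (extendW (ℓ+1) D w) i x) /
      Real.sqrt (D i)) (g := fun w => |preact D (extendW (ℓ+1) D w) i x j|) ?_ ?_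
    · unfold evNorm
      refine ((Measurable.sqrt (Finset.measurable_sum _ fun k _ =>
        (forward_meas (ℓ+1) D x i k).pow_const 2)).const_mul a).div_const _
    · unfold preact
      exact (Finset.measurable_sum _ fun k _ =>
        (extendW_meas (ℓ+1) D i j k).mul (forward_meas (ℓ+1) D x i k)).abs
  · intro w
    refine le_trans (le_of_eq ?_) (layer_bound hn (forward D (extendW (ℓ+1) D w) i x) a ha)
    congr 1
    ext y
    have e1 : forward D (extendW (ℓ+1) D (Function.update w ⟨i, by omega⟩ y)) i x =
        forward D (extendW (ℓ+1) D w) i x := by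
      apply forward_congr
      intro k hk
      have hk' : k < ℓ + 1 := by omega
      simp only [extendW, hk', dite_true]
      rw [Function.update_of_ne]
      intro h
      simp only [Fin.mk.injEq] at h
      omega
    have e2 : extendW (ℓ+1) D (Function.update w ⟨i, by omega⟩ y) i = y := by
      have hk' : i < ℓ + 1 := by omega
      simp only [extendW, hk', dite_true, Function.update_self]
    simp only [Set.mem_ofPred_eq, preact, e1, e2]

/-- **Statement 7** (Lemma 2.4 of the paper): at a fixed nonzero input `x`, for each layer,
most rows of the next weight matrix have a non-negligible inner product with the image of `x`:
`#{j : |⟨(W_{i+1})_j, f_i(x)⟩| ≥ α_i ‖f_i(x)‖/√(d_i)} ≥ (1 − 2√(2/π) α_i) d_{i+1}`. -/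
theorem stmt7 :
    ∃ c : ℝ, 0 < c ∧
      ∀ (ℓ : ℕ) (D : ℕ → ℕ) (δ : ℝ), δ ∈ Set.Ioo (0:ℝ) 1 →
      ∀ α : ℕ → ℝ, (∀ i : ℕ, 1 ≤ i → i ≤ ℓ → α i ∈ Set.Ioo (0:ℝ) 1) →
      (∀ i : ℕ, 1 ≤ i → i ≤ ℓ → α i ≥ c * Real.sqrt (Real.log (ℓ / δ) / (D (i+1)))) →
      ∀ x : Fin (D 0) → ℝ, x ≠ 0 →
        hiddenMeasure (ℓ+1) D {w | ∀ i : ℕ, 1 ≤ i → i ≤ ℓ →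
            ((Set.ncard {j : Fin (D (i+1)) |
                |preact D (extendW (ℓ+1) D w) i x j| ≥
                  α i * evNorm (forward D (extendW (ℓ+1) D w) i x) / Real.sqrt (D i)} : ℝ) ≥
              (1 - 2 * Real.sqrt (2 / Real.pi) * α i) * (D (i+1) : ℝ))} ≥
          ENNReal.ofReal (1 - δ) := by


  refine ⟨1, one_pos, ?_⟩
  intro ℓ D δ hδ α hα hαc x hx
  set μ := hiddenMeasure (ℓ+1) D with hμ
  have : IsProbabilityMeasure μ := by rw [hμ]; unfold hiddenMeasure; infer_instance
  set G : ℕ → Set (∀ i : Fin (ℓ+1), Fin (D (i.1+1)) → Fin (D i.1) → ℝ) := fun i =>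
    {w | ((Set.ncard {j : Fin (D (i+1)) |
                |preact D (extendW (ℓ+1) D w) i x j| ≥
                  α i * evNorm (forward D (extendW (ℓ+1) D w) i x) / Real.sqrt (D i)} : ℝ) ≥
              (1 - 2 * Real.sqrt (2 / Real.pi) * α i) * (D (i+1) : ℝ))} with hG
  have hbad : ∀ i ∈ Finset.Icc 1 ℓ, μ (G i)ᶜ ≤ ENNReal.ofReal (δ / ℓ) := by
    intro i hi
    obtain ⟨h1, h2⟩ := Finset.mem_Icc.1 hi
    have hl : (1:ℝ) ≤ ℓ := by exact_mod_cast h1.trans h2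
    by_cases hn : D (i+1) = 0
    · have : (G i)ᶜ = ∅ := by
        rw [Set.compl_empty_iff, Set.eq_univ_iff_forall]
        intro w
        simp only [hG, Set.mem_ofPred_eq]
        have hz : (D (i+1) : ℝ) = 0 := by exact_mod_cast hn
        simp only [hz, mul_zero]
        positivity
      rw [this]; simp
    · refine (bad_layer ℓ D x i h2 (α i) (hα i h1 h2).1.le hn).trans ?_
      apply ENNReal.ofReal_le_ofReal
      have hn' : (0:ℝ) < D (i+1) := by positivity
      have hpos : 0 < ℓ / δ := div_pos (by linarith) hδ.1
      have hlog : 0 ≤ Real.log (ℓ / δ) := by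
        apply Real.log_nonneg
        rw [le_div_iff₀ hδ.1]; linarith [hδ.2]
      have hc := hαc i h1 h2
      rw [one_mul] at hc
      have hsq := (Real.sqrt_le_left (hα i h1 h2).1.le).1 hc
      rw [div_le_iff₀ hn'] at hsq
      calc Real.exp (-(α i ^ 2 * D (i+1))) ≤ Real.exp (-Real.log (ℓ / δ)) :=
            Real.exp_le_exp.2 (by linarith)
        _ = δ / ℓ := by rw [Real.exp_neg, Real.exp_log hpos, inv_div]
  set S : Set (∀ i : Fin (ℓ+1), Fin (D (i.1+1)) → Fin (D i.1) → ℝ) :=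
    {w | ∀ i : ℕ, 1 ≤ i → i ≤ ℓ → w ∈ G i} with hS
  change μ S ≥ _
  have hSc : μ Sᶜ ≤ ENNReal.ofReal δ := by
    calc μ Sᶜ ≤ μ (⋃ i ∈ Finset.Icc 1 ℓ, (G i)ᶜ) := by
          apply measure_mono
          intro w hw
          simp only [hS, Set.mem_compl_iff, Set.mem_ofPred_eq, not_forall] at hw
          obtain ⟨i, h1, h2, h3⟩ := hw
          simp only [Set.mem_iUnion]
          exact ⟨i, Finset.mem_Icc.2 ⟨h1, h2⟩, h3⟩
      _ ≤ ∑ i ∈ Finset.Icc 1 ℓ, μ (G i)ᶜ := measure_biUnion_finset_le _ _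
      _ ≤ ∑ i ∈ Finset.Icc 1 ℓ, ENNReal.ofReal (δ / ℓ) := Finset.sum_le_sum hbad
      _ ≤ ENNReal.ofReal δ := by
          rw [Finset.sum_const, Nat.card_Icc, Nat.add_sub_cancel, nsmul_eq_mul]
          rw [← ENNReal.ofReal_natCast, ← ENNReal.ofReal_mul (by positivity)]
          apply ENNReal.ofReal_le_ofReal
          rcases Nat.eq_zero_or_pos ℓ with h | h
          · simp [h, hδ.1.le]
          · rw [mul_div_cancel₀]; positivity
  have hone : 1 ≤ μ S + μ Sᶜ := by
    rw [← measure_univ (μ := μ), ← Set.union_compl_self S]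
    exact measure_union_le _ _
  rw [ge_iff_le, ENNReal.ofReal_sub _ hδ.1.le, ENNReal.ofReal_one, tsub_le_iff_right]
  exact hone.trans (by gcongr)

end
end
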